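/- arXiv:1605.01557 — 8 statements merged into one kernel-verified Lean document; each statement's English description precedes it below -/
import Mathlib

section
/- (Schur-concavity of the fairness measures; Proposition 1.) Let n ≥ 1 and let x, y ∈ ℝ_{≥0}^n with x majorized by y. Then: (i) if ∑_{i=1}^n y_i > 0, then F_J(x) ≥ F_J(y); and (ii) if all components of x and of y are strictly positive, then F_α(x) ≥ F_α(y) for every real α ≥ 0. -/
open scoped BigOperators

/-- Jain's fairness of a vector `x ∈ ℝ^n`. -/
noncomputable def jain {n : ℕ} (x : Fin n → ℝ) : ℝ :=
  (∑ i, x i) ^ 2 / ((n : ℝ) * ∑ i, (x i) ^ 2)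

/-- The `α`-fair utility function. -/
noncomputable def Ualpha (α z : ℝ) : ℝ :=
  if α = 1 then Real.log z else z ^ (1 - α) / (1 - α)

/-- The `α`-fair objective (sum-user utility). -/
noncomputable def Falpha (α : ℝ) {n : ℕ} (x : Fin n → ℝ) : ℝ := ∑ i, Ualpha α (x i)

/-- `x` is majorized by `y`: the sums agree and for every `k ∈ {1,…,n}` the maximum
of `∑_{i∈S} x_i` over `k`-element subsets `S` is at most the corresponding maximum for `y`. -/
def Maj {n : ℕ} (x y : Fin n → ℝ) : Prop :=
  (∑ i, x i = ∑ i, y i) ∧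
  ∀ k : ℕ, 1 ≤ k → k ≤ n → ∀ S : Finset (Fin n), S.card = k →
    ∃ S' : Finset (Fin n), S'.card = k ∧ ∑ i ∈ S, x i ≤ ∑ i ∈ S', y i

/-- Abel summation: an antitone weight against a vector with nonnegative prefix sums. -/
lemma Antitone.last_mul_sum_le {n : ℕ} {c d : Fin (n + 1) → ℝ} (hc : Antitone c)
    (hd : ∀ (k : ℕ) (hk : k ≤ n + 1), 0 ≤ ∑ i : Fin k, d (Fin.castLE hk i)) :
    c (Fin.last n) * ∑ i, d i ≤ ∑ i, c i * d i := by
  induction n with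
  | zero => simp
  | succ n ih =>
    have hprev := ih (c := fun i => c i.castSucc) (d := fun i => d i.castSucc)
      (fun i j hij => hc (Fin.castSucc_le_castSucc_iff.2 hij))
      (fun k hk => hd k (hk.trans (Nat.le_succ _)))
    have hpos : 0 ≤ ∑ i : Fin (n + 1), d i.castSucc := hd (n + 1) (Nat.le_succ _)
    have hle : c (Fin.last (n + 1)) ≤ c (Fin.last n).castSucc := hc (Fin.le_last _)
    rw [Fin.sum_univ_castSucc, Fin.sum_univ_castSucc (fun i => c i * d i), mul_add]
    nlinarith [mul_le_mul_of_nonneg_right hle hpos]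

/-- The first `k` entries of an antitone vector have the largest sum among `k` entries. -/
lemma Antitone.sum_le_sum_prefix {n k : ℕ} {w : Fin n → ℝ} (hw : Antitone w) (hk : k ≤ n)
    (S : Finset (Fin n)) (hS : S.card = k) :
    ∑ i ∈ S, w i ≤ ∑ i : Fin k, w (Fin.castLE hk i) := by
  obtain rfl | hk0 := Nat.eq_zero_or_pos k
  · simp [Finset.card_eq_zero.1 hS]
  set t := w ⟨k - 1, by omega⟩
  set P : Finset (Fin n) := Finset.univ.map (Fin.castLEEmb hk)
  have hP : ∀ i, i ∈ P ↔ (i : ℕ) < k := by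
    intro i
    simp only [P, Finset.mem_map, Finset.mem_univ, true_and]
    exact ⟨fun ⟨j, hj⟩ => hj ▸ j.2, fun h => ⟨⟨i, h⟩, rfl⟩⟩
  have hsum : ∑ i ∈ S, (w i - t) ≤ ∑ i ∈ P, (w i - t) := by
    calc ∑ i ∈ S, (w i - t) ≤ ∑ i ∈ S ∩ P, (w i - t) := by
          have hdiff : ∑ i ∈ S \ P, (w i - t) ≤ 0 := Finset.sum_nonpos fun i hi =>
            sub_nonpos.2 (hw (Fin.le_def.2 (by
              have := mt (hP i).2 (Finset.mem_sdiff.1 hi).2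
              simp
              omega)))
          rw [← Finset.sum_inter_add_sum_sdiff S P]
          linarith
      _ ≤ ∑ i ∈ P, (w i - t) :=
          Finset.sum_le_sum_of_subset_of_nonneg Finset.inter_subset_right fun i hi _ =>
            sub_nonneg.2 (hw (Fin.le_def.2 (by have := (hP i).1 hi; simp; omega)))
  have hPcard : P.card = k := by simp [P]
  have hPsum : ∑ i ∈ P, w i = ∑ i : Fin k, w (Fin.castLE hk i) := by simp [P]
  simp only [Finset.sum_sub_distrib, Finset.sum_const, hS, hPcard] at hsum
  linarith

lemma exists_perm_antitone {n : ℕ} (x : Fin n → ℝ) :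
    ∃ σ : Equiv.Perm (Fin n), Antitone (x ∘ σ) :=
  ⟨Tuple.sort (fun i => -x i), fun _ _ hij =>
    neg_le_neg_iff.1 (Tuple.monotone_sort (fun i => -x i) hij)⟩

/-- Karamata's inequality for a function `f` with a monotone choice `g` of supporting slopes. -/
lemma Maj.sum_le_sum {n : ℕ} {x y : Fin n → ℝ} (h : Maj x y) {s : Set ℝ}
    (hx : ∀ i, x i ∈ s) (hy : ∀ i, y i ∈ s) {f g : ℝ → ℝ} (hg : MonotoneOn g s)
    (hfg : ∀ a ∈ s, ∀ b ∈ s, f a + g a * (b - a) ≤ f b) :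
    ∑ i, f (x i) ≤ ∑ i, f (y i) := by
  obtain _ | n := n
  · simp
  obtain ⟨σ, hσ⟩ := exists_perm_antitone x
  obtain ⟨τ, hτ⟩ := exists_perm_antitone y
  have hsumx := Equiv.sum_comp σ x
  have hsumy := Equiv.sum_comp τ y
  have habel := Antitone.last_mul_sum_le
    (c := fun i => g (x (σ i))) (d := fun i => y (τ i) - x (σ i))
    (fun i j hij => hg (hx _) (hx _) (hσ hij)) (fun k hk => by
      rw [Finset.sum_sub_distrib, sub_nonneg]
      obtain rfl | hk0 := Nat.eq_zero_or_pos k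
      · simp
      obtain ⟨S, hS, hle⟩ := h.2 k hk0 hk
        (Finset.univ.map ((Fin.castLEEmb hk).trans σ.toEmbedding)) (by simp)
      have htop := hτ.sum_le_sum_prefix hk (S.map τ.symm.toEmbedding) (by simpa using hS)
      simp only [Finset.sum_map] at hle htop
      simpa using hle.trans (by simpa using htop))
  rw [Finset.sum_sub_distrib, hsumx, hsumy, h.1, sub_self, mul_zero] at habel
  rw [← Equiv.sum_comp σ (fun i => f (x i)), ← Equiv.sum_comp τ (fun i => f (y i))]
  have := Finset.sum_le_sum fun i (_ : i ∈ Finset.univ) =>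
    hfg (x (σ i)) (hx _) (y (τ i)) (hy _)
  rw [Finset.sum_add_distrib] at this
  linarith

lemma Ualpha_le_tangent {α a b : ℝ} (hα : 0 ≤ α) (ha : 0 < a) (hb : 0 < b) :
    Ualpha α b ≤ Ualpha α a + a ^ (-α) * (b - a) := by
  have hba : 0 < b / a := div_pos hb ha
  unfold Ualpha
  split_ifs with h
  · subst h
    have hlog := Real.log_le_sub_one_of_pos hba
    rw [Real.log_div hb.ne' ha.ne'] at hlog
    rw [Real.rpow_neg_one]
    have : a⁻¹ * (b - a) = b / a - 1 := by field_simp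
    linarith
  · have hbern : (b / a) ^ (1 - α) / (1 - α) ≤ 1 / (1 - α) + (b / a - 1) := by
      obtain h1 | h1 := lt_or_gt_of_ne h
      · have hp : 0 < 1 - α := by linarith
        have := rpow_one_add_le_one_add_mul_self (s := b / a - 1) (by linarith) hp.le
          (by linarith)
        rw [add_sub_cancel] at this
        rw [div_add' _ _ _ hp.ne']
        gcongr
        linarith
      · have hp : 1 - α < 0 := by linarith
        have hexp := Real.add_one_le_exp (Real.log (b / a) * (1 - α))
        rw [← Real.rpow_def_of_pos hba] at hexp
        have hlog := mul_le_mul_of_nonpos_right (Real.log_le_sub_one_of_pos hba) hp.le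
        rw [div_add' _ _ _ hp.ne]
        exact div_le_div_of_nonpos_of_le hp.le (by linarith)
    have hbpow : b ^ (1 - α) = a ^ (1 - α) * (b / a) ^ (1 - α) := by
      rw [← Real.mul_rpow ha.le hba.le, mul_div_cancel₀ _ ha.ne']
    have hapow : a ^ (1 - α) = a ^ (-α) * a := by
      rw [← Real.rpow_add_one ha.ne']; ring_nf
    calc b ^ (1 - α) / (1 - α) = a ^ (1 - α) * ((b / a) ^ (1 - α) / (1 - α)) := by
          rw [hbpow, mul_div_assoc]
      _ ≤ a ^ (1 - α) * (1 / (1 - α) + (b / a - 1)) := by gcongr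
      _ = a ^ (1 - α) / (1 - α) + a ^ (1 - α) * (b / a - 1) := by ring
      _ = a ^ (1 - α) / (1 - α) + a ^ (-α) * (b - a) := by
          congr 1
          rw [hapow]
          field_simp

theorem schur_concavity_of_fairness_measures
    (n : ℕ) (hn : 1 ≤ n) (x y : Fin n → ℝ)
    (hx : ∀ i, 0 ≤ x i) (hy : ∀ i, 0 ≤ y i) (hmaj : Maj x y) :
    ((0 < ∑ i, y i) → jain y ≤ jain x) ∧
    ((∀ i, 0 < x i) → (∀ i, 0 < y i) →
      ∀ α : ℝ, 0 ≤ α → Falpha α y ≤ Falpha α x) := by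
  refine ⟨fun hpos => ?_, fun hx' hy' α hα => ?_⟩
  · have hsq : ∑ i, x i ^ 2 ≤ ∑ i, y i ^ 2 :=
      hmaj.sum_le_sum (s := Set.univ) (f := fun z => z ^ 2) (g := fun z => 2 * z)
        (fun _ => trivial) (fun _ => trivial) (fun a _ b _ hab => by dsimp only; linarith)
        (fun a _ b _ => by nlinarith [sq_nonneg (b - a)])
    have hxpos : 0 < ∑ i, x i ^ 2 := by
      obtain ⟨i, hi, hne⟩ := Finset.exists_ne_zero_of_sum_ne_zero (hmaj.1 ▸ hpos).ne'
      exact Finset.sum_pos' (fun j _ => sq_nonneg _) ⟨i, hi, by positivity⟩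
    have hn' : (0 : ℝ) < n := by exact_mod_cast hn
    unfold jain
    rw [hmaj.1]
    gcongr
  · have hneg := hmaj.sum_le_sum (s := Set.Ioi 0) (f := fun z => -Ualpha α z)
      (g := fun z => -z ^ (-α)) hx' hy'
      (fun a ha b _ hab => neg_le_neg
        (Real.rpow_le_rpow_of_nonpos ha hab (neg_nonpos.2 hα)))
      (fun a ha b hb => by linarith [Ualpha_le_tangent hα ha hb])
    simpa [Falpha] using hneg
end

section
/- (Proposition 2, item 1.) Fix an integer n ≥ 2 and θ ∈ (θ_n, 1), where θ_n = (1 − 1/n)^{n−1}. If x ∈ Λ satisfies T(x) = θ and x ∉ ∂Λ, then there exists x' ∈ ∂Λ with T(x') = θ such that x' is majorized by x. -/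
open scoped BigOperators

/-- The worst-case service rate of user `i` under control `p`. -/
noncomputable def rate {n : ℕ} (p : Fin n → ℝ) (i : Fin n) : ℝ :=
  p i * ∏ j ∈ Finset.univ.erase i, (1 - p j)

/-- The inner bound `Λ` of the slotted-Aloha stability region. -/
def Lam (n : ℕ) : Set (Fin n → ℝ) :=
  {x | (∀ i, 0 ≤ x i) ∧
    ∃ p : Fin n → ℝ, (∀ i, p i ∈ Set.Icc (0:ℝ) 1) ∧ ∀ i, x i ≤ rate p i}

/-- The boundary `∂Λ` of `Λ`: rate vectors of controls that are probability vectors. -/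
def LamBd (n : ℕ) : Set (Fin n → ℝ) :=
  {x | ∃ p : Fin n → ℝ, (∀ i, p i ∈ Set.Icc (0:ℝ) 1) ∧ (∑ i, p i) = 1 ∧
    ∀ i, x i = rate p i}

/-- The critical throughput `θ_t = (1 - 1/t)^(t-1)`. -/
noncomputable def crit (t : ℕ) : ℝ := (1 - 1 / (t : ℝ)) ^ (t - 1)

/-- If `s` is a positive minimizer of `r ↦ ∏ i, (1 + r * x i) - r` with minimum value zero, then
`x` is the rate vector of the probability vector with entries `s * x i / (1 + s * x i)`. -/
theorem mem_LamBd_of_prod_eq {n : ℕ} {x : Fin n → ℝ} (hx : ∀ i, 0 ≤ x i) {s : ℝ} (hs : 0 < s)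
    (heq : ∏ i, (1 + s * x i) = s) (hmin : ∀ r, 0 < r → r ≤ ∏ i, (1 + r * x i)) :
    x ∈ LamBd n := by
  have hpos : ∀ i, 0 < 1 + s * x i := fun i => by
    have := mul_nonneg hs.le (hx i)
    linarith
  have herase : ∀ i, ∏ j ∈ Finset.univ.erase i, (1 + s * x j) = s / (1 + s * x i) := fun i => by
    rw [eq_div_iff (hpos i).ne', Finset.prod_erase_mul _ _ (Finset.mem_univ i), heq]
  refine ⟨fun i => s * x i / (1 + s * x i), fun i => ⟨?_, ?_⟩, ?_, fun i => ?_⟩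
  · exact div_nonneg (mul_nonneg hs.le (hx i)) (hpos i).le
  · rw [div_le_one (hpos i)]
    linarith
  · have hd : HasDerivAt (fun r : ℝ => ∏ i, (1 + r * x i) - r)
        (∑ i, (∏ j ∈ Finset.univ.erase i, (1 + s * x j)) • x i - 1) s := by
      refine HasDerivAt.sub (HasDerivAt.fun_finsetProd fun i _ => ?_) (hasDerivAt_id s)
      simpa using ((hasDerivAt_id s).mul_const (x i)).const_add 1
    have hloc : IsLocalMin (fun r : ℝ => ∏ i, (1 + r * x i) - r) s := by
      filter_upwards [lt_mem_nhds hs] with r hr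
      rw [heq, sub_self]
      exact sub_nonneg.2 (hmin r hr)
    rw [← sub_eq_zero, ← hloc.hasDerivAt_eq_zero hd]
    congr 1
    refine Finset.sum_congr rfl fun i _ => ?_
    rw [herase, smul_eq_mul]
    ring
  · have h1 : ∀ j, 1 - s * x j / (1 + s * x j) = (1 + s * x j)⁻¹ := fun j => by
      have := (hpos j).ne'
      field_simp
      ring
    have := (hpos i).ne'
    simp only [rate, h1, Finset.prod_inv_distrib, herase, inv_div]
    generalize 1 + s * x i = q at this
    field_simp

theorem exists_prod_le_of_mem_Lam {n : ℕ} {x : Fin n → ℝ} (hx : x ∈ Lam n)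
    (hlt : ∑ i, x i < 1) : ∃ s, 0 < s ∧ ∏ i, (1 + s * x i) ≤ s := by
  obtain ⟨h0, p, hp, hxp⟩ := hx
  by_cases h : ∃ i, p i = 1
  · obtain ⟨i, hi⟩ := h
    have hz : ∀ j, j ≠ i → x j = 0 := fun j hj => by
      refine le_antisymm ((hxp j).trans_eq ?_) (h0 j)
      have hmem : i ∈ Finset.univ.erase j := Finset.mem_erase.2 ⟨hj.symm, Finset.mem_univ i⟩
      rw [rate, Finset.prod_eq_zero hmem (by rw [hi, sub_self]), mul_zero]
    rw [Fintype.sum_eq_single i hz] at hlt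
    have hpos : 0 < 1 - x i := sub_pos.2 hlt
    refine ⟨(1 - x i)⁻¹, inv_pos.2 hpos, ?_⟩
    rw [Fintype.prod_eq_single i fun j hj => by rw [hz j hj, mul_zero, add_zero]]
    refine le_of_eq ?_
    field_simp
    ring
  · push Not at h
    have hpos : ∀ i, 0 < 1 - p i := fun i => sub_pos.2 (lt_of_le_of_ne (hp i).2 (h i))
    have hprod : 0 < ∏ i, (1 - p i) := Finset.prod_pos fun i _ => hpos i
    refine ⟨(∏ i, (1 - p i))⁻¹, inv_pos.2 hprod, ?_⟩
    have hle : ∏ i, (1 + (∏ j, (1 - p j))⁻¹ * x i) ≤ ∏ i, (1 - p i)⁻¹ := by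
      refine Finset.prod_le_prod (fun i _ => ?_) fun i _ => ?_
      · have := mul_nonneg (inv_pos.2 hprod).le (h0 i)
        linarith
      · have herase : ∏ j ∈ Finset.univ.erase i, (1 - p j) = (∏ j, (1 - p j)) / (1 - p i) := by
          rw [eq_div_iff (hpos i).ne', Finset.prod_erase_mul _ _ (Finset.mem_univ i)]
        have hmul := mul_le_mul_of_nonneg_left (hxp i) (inv_pos.2 hprod).le
        have hrate : (∏ j, (1 - p j))⁻¹ * rate p i = (1 - p i)⁻¹ - 1 := by
          have h1 := (hpos i).ne'
          have h2 := hprod.ne'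
          rw [rate, herase]
          generalize ∏ j, (1 - p j) = q at h2
          field_simp
          ring
        linarith
    rwa [Finset.prod_inv_distrib] at hle

/-- Above the critical throughput the uniform vector lies outside `Λ`. -/
theorem lt_uniform_pow_of_crit_lt {n : ℕ} (hn : 2 ≤ n) {θ : ℝ} (hθ : crit n < θ) {s : ℝ}
    (hs : 0 < s) : s < (1 + s * (θ / n)) ^ n := by
  obtain ⟨m, rfl⟩ : ∃ m, n = m + 1 := ⟨n - 1, by omega⟩
  have hm : (0 : ℝ) < m := by
    have : 0 < m := by omega
    exact_mod_cast this
  have hcrit : crit (m + 1) = (m / (m + 1)) ^ m := by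
    rw [crit, Nat.add_sub_cancel]
    congr 1
    push_cast
    field_simp
    ring
  rw [hcrit] at hθ
  have hc : (0 : ℝ) < (m / (m + 1)) ^ m := by positivity
  have hθ0 : 0 < θ := hc.trans hθ
  push_cast
  have hbern : m * (s * (θ / (m + 1))) ≤
      ((m / (m + 1)) * (1 + s * (θ / (m + 1)))) ^ (m + 1) := by
    have := one_add_mul_le_pow (a := (m * (s * (θ / (m + 1))) - 1) / (m + 1)) (by
      rw [le_div_iff₀ (by positivity)]
      have : 0 ≤ m * (s * (θ / (m + 1))) := by positivity
      linarith) (m + 1)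
    have hm1 : (m : ℝ) + 1 ≠ 0 := by positivity
    push_cast at this
    have hleft : 1 + (m + 1) * ((m * (s * (θ / (m + 1))) - 1) / (m + 1)) =
        m * (s * (θ / (m + 1))) := by
      rw [mul_div_cancel₀ _ hm1]
      ring
    have hright : 1 + (m * (s * (θ / (m + 1))) - 1) / (m + 1) =
        m / (m + 1) * (1 + s * (θ / (m + 1))) := by
      field_simp
      ring
    rwa [hleft, hright] at this
  rw [mul_pow, pow_succ] at hbern
  have hstep : s * θ ≤ (m / (m + 1)) ^ m * (1 + s * (θ / (m + 1))) ^ (m + 1) := by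
    refine le_of_mul_le_mul_left ?_ (show (0 : ℝ) < m / (m + 1) by positivity)
    calc (m / (m + 1)) * (s * θ) = m * (s * (θ / (m + 1))) := by ring
      _ ≤ _ := hbern
      _ = _ := by ring
  have hlt := (mul_lt_mul_of_pos_left hθ hs).trans_le hstep
  rw [mul_comm] at hlt
  exact lt_of_mul_lt_mul_left hlt hc.le

theorem exists_card_eq_average_le_sum {n : ℕ} (hn : 0 < n) (x : Fin n → ℝ) (S : Finset (Fin n)) :
    ∃ S' : Finset (Fin n), S'.card = S.card ∧
      (S.card : ℝ) * ((∑ i, x i) / n) ≤ ∑ i ∈ S', x i := by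
  have : NeZero n := ⟨hn.ne'⟩
  have hn0 : (n : ℝ) ≠ 0 := by exact_mod_cast hn.ne'
  have hsum : ∑ g : Fin n, (S.card : ℝ) * ((∑ i, x i) / n) ≤ ∑ g : Fin n, ∑ i ∈ S, x (i + g) := by
    rw [Finset.sum_comm]
    have : ∀ i ∈ S, ∑ g, x (i + g) = ∑ i, x i := fun i _ =>
      Equiv.sum_comp (Equiv.addLeft i) x
    rw [Finset.sum_congr rfl this]
    simp only [Finset.sum_const, Finset.card_univ, Fintype.card_fin, nsmul_eq_mul]
    refine le_of_eq ?_
    field_simp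
  obtain ⟨g, -, hg⟩ := Finset.exists_le_of_sum_le Finset.univ_nonempty hsum
  refine ⟨S.map (Equiv.addRight g).toEmbedding, Finset.card_map _, ?_⟩
  simpa using hg

theorem maj_segment_uniform {n : ℕ} (hn : 0 < n) (x : Fin n → ℝ) {t : ℝ} (ht : t ∈ Set.Icc 0 1) :
    Maj (fun i => (1 - t) * x i + t * ((∑ i, x i) / n)) x := by
  have hn0 : (n : ℝ) ≠ 0 := by exact_mod_cast hn.ne'
  have hsum : ∀ S : Finset (Fin n), ∑ i ∈ S, ((1 - t) * x i + t * ((∑ i, x i) / n)) =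
      (1 - t) * ∑ i ∈ S, x i + t * (S.card * ((∑ i, x i) / n)) := fun S => by
    rw [Finset.sum_add_distrib, ← Finset.mul_sum, Finset.sum_const, nsmul_eq_mul]
    ring
  refine ⟨?_, fun k _ _ S hS => ?_⟩
  · rw [hsum, Finset.card_univ, Fintype.card_fin]
    field_simp
    ring
  · obtain ⟨S', hcard, hS'⟩ := exists_card_eq_average_le_sum hn x S
    have h1 : 0 ≤ 1 - t := sub_nonneg.2 ht.2
    rw [hsum]
    rcases le_total (∑ i ∈ S, x i) (∑ i ∈ S', x i) with h | h
    · refine ⟨S', hcard.trans hS, ?_⟩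
      linarith [mul_le_mul_of_nonneg_left h h1, mul_le_mul_of_nonneg_left hS' ht.1]
    · refine ⟨S, hS, ?_⟩
      linarith [mul_le_mul_of_nonneg_left (hS'.trans h) ht.1]

/-- If `F 0` dips strictly below the identity but `F 1` stays strictly above it, then at some
intermediate parameter the graph of `F t` touches the identity from above. -/
theorem exists_touching {F : ℝ → ℝ → ℝ} (hF : Continuous (Function.uncurry F))
    (hbdd : ∀ a, 0 < a → ∃ B, ∀ t ∈ Set.Icc a 1, ∀ s, 0 < s → F t s ≤ s → 1 ≤ s ∧ s ≤ B)
    (h0 : ∃ s, 0 < s ∧ F 0 s < s) (h1 : ∀ s, 0 < s → s < F 1 s) :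
    ∃ t ∈ Set.Icc (0 : ℝ) 1, ∃ s, 0 < s ∧ F t s = s ∧ ∀ r, 0 < r → r ≤ F t r := by
  have hright : ∀ t s, t < 1 → F t s < s → ∃ u, t < u ∧ u ≤ 1 ∧ F u s < s := fun t s ht hs => by
    have hc : Continuous fun u => F u s := hF.comp (by fun_prop : Continuous fun u => (u, s))
    have hev : ∀ᶠ u in nhdsWithin t (Set.Ioi t), F u s < s :=
      nhdsWithin_le_nhds ((hc.tendsto t).eventually (gt_mem_nhds hs))
    obtain ⟨u, hu, hu1⟩ := (hev.and (Ioc_mem_nhdsGT ht)).exists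
    exact ⟨u, hu1.1, hu1.2, hu⟩
  obtain ⟨s₀, hs₀, hlt₀⟩ := h0
  obtain ⟨a, ha, ha1, hlta⟩ := hright 0 s₀ one_pos hlt₀
  obtain ⟨B, hB⟩ := hbdd a ha
  set K : Set (ℝ × ℝ) := (Set.Icc a 1 ×ˢ Set.Icc 1 B) ∩ {z | Function.uncurry F z ≤ z.2} with hK
  have hKc : IsCompact K :=
    (isCompact_Icc.prod isCompact_Icc).inter_right (isClosed_le hF continuous_snd)
  have hmem : ∀ t ∈ Set.Icc a 1, ∀ s, 0 < s → F t s ≤ s → (t, s) ∈ K := fun t ht s hs h =>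
    ⟨⟨ht, hB t ht s hs h⟩, h⟩
  obtain ⟨⟨t, s⟩, ⟨⟨ht, hs⟩, hle⟩, hmax⟩ := hKc.exists_isMaxOn
    ⟨_, hmem a ⟨le_rfl, ha1⟩ s₀ hs₀ hlta.le⟩ continuous_fst.continuousOn
  have hs0 : 0 < s := one_pos.trans_le hs.1
  have ht1 : t < 1 := lt_of_le_of_ne ht.2 fun h => by
    subst h
    exact (h1 s hs0).not_ge hle
  have hmin : ∀ r, 0 < r → r ≤ F t r := fun r hr => by
    by_contra! h
    obtain ⟨u, hu, hu1, hult⟩ := hright t r ht1 h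
    exact hu.not_ge (hmax (hmem u ⟨ht.1.trans hu.le, hu1⟩ r hr hult.le))
  exact ⟨t, ⟨ha.le.trans ht.1, ht.2⟩, s, hs0, le_antisymm hle (hmin s hs0), hmin⟩

/-- When all entries of `y` are at least `c > 0`, solutions of `∏ i, (1 + s * y i) ≤ s` are
bounded. -/
theorem bounds_of_prod_le {n : ℕ} (hn : 2 ≤ n) {y : Fin n → ℝ} {c s : ℝ} (hc : 0 < c)
    (hy : ∀ i, c ≤ y i) (hs : 0 < s) (h : ∏ i, (1 + s * y i) ≤ s) : 1 ≤ s ∧ s ≤ (c ^ 2)⁻¹ := by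
  have h1 : 1 ≤ 1 + s * c := by linarith [mul_pos hs hc]
  have hpow : (1 + s * c) ^ n ≤ s := by
    refine le_trans ?_ h
    calc (1 + s * c) ^ n = ∏ _i : Fin n, (1 + s * c) := by simp
      _ ≤ _ := Finset.prod_le_prod (fun i _ => by linarith)
        fun i _ => by linarith [mul_le_mul_of_nonneg_left (hy i) hs.le]
  refine ⟨(one_le_pow₀ h1).trans hpow, ?_⟩
  have hsq : (1 + s * c) ^ 2 ≤ s := (pow_le_pow_right₀ h1 hn).trans hpow
  rw [← one_div, le_div_iff₀ (by positivity)]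
  refine le_of_mul_le_mul_left ?_ hs
  nlinarith [mul_pos hs hc]

theorem interior_point_majorizes_boundary_point
    (n : ℕ) (hn : 2 ≤ n) (θ : ℝ) (hθ : θ ∈ Set.Ioo (crit n) 1)
    (x : Fin n → ℝ) (hx : x ∈ Lam n) (hT : ∑ i, x i = θ) (hnb : x ∉ LamBd n) :
    ∃ x' : Fin n → ℝ, x' ∈ LamBd n ∧ (∑ i, x' i = θ) ∧ Maj x' x := by
  have hn0 : 0 < n := by omega
  have hnR : (0 : ℝ) < n := by exact_mod_cast hn0
  have hx0 : ∀ i, 0 ≤ x i := hx.1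
  obtain ⟨s, hs, hle⟩ := exists_prod_le_of_mem_Lam hx (hT.trans_lt hθ.2)
  have hstrict : ∃ s, 0 < s ∧ ∏ i, (1 + s * x i) < s := by
    by_contra! h
    exact hnb (mem_LamBd_of_prod_eq hx0 hs (le_antisymm hle (h s hs)) h)
  have hθ0 : 0 < θ := by
    refine lt_of_le_of_lt (pow_nonneg (sub_nonneg.2 ?_) _) hθ.1
    rw [div_le_one hnR]
    exact_mod_cast hn0
  have hu : 0 < θ / n := div_pos hθ0 hnR
  obtain ⟨t, ht, s, hs, heq, hmin⟩ := exists_touching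
    (F := fun t s => ∏ i, (1 + s * ((1 - t) * x i + t * (θ / n))))
    (by unfold Function.uncurry; fun_prop)
    (fun a ha => ⟨((a * (θ / n)) ^ 2)⁻¹, fun t ht s hs h =>
      bounds_of_prod_le hn (mul_pos ha hu) (fun i => by
        linarith [mul_nonneg (sub_nonneg.2 ht.2) (hx0 i),
          mul_le_mul_of_nonneg_right ht.1 hu.le]) hs h⟩)
    (by simpa using hstrict)
    (fun s hs => by simpa using lt_uniform_pow_of_crit_lt hn hθ.1 hs)
  have hmaj := maj_segment_uniform hn0 x ht
  rw [hT] at hmaj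
  exact ⟨_, mem_LamBd_of_prod_eq
    (fun i => add_nonneg (mul_nonneg (sub_nonneg.2 ht.2) (hx0 i)) (mul_nonneg ht.1 hu.le))
    hs heq hmin, hmaj.1.trans hT, hmaj⟩
end

section
/- (Lemma on strictly convex sets and convex hulls; Appendix Lemma 2.) Let n ≥ 1 and let V = {v_1, …, v_m} ⊂ ℝ^n be a finite set of m ≥ 2 distinct points such that no v_i lies in the convex hull of V \ {v_i}. Let C_s ⊆ ℝ^n be a closed, strictly convex set whose frontier (topological boundary) contains V. Then the intersection of the frontier of C_s with the convex hull of V is exactly V. -/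
/-- A set `C` is strictly convex if every nontrivial convex combination of two
distinct points of `C` lies in the topological interior of `C`. -/
def StrictConvexSet {E : Type*} [AddCommGroup E] [Module ℝ E] [TopologicalSpace E]
    (C : Set E) : Prop :=
  ∀ ⦃u⦄, u ∈ C → ∀ ⦃v⦄, v ∈ C → u ≠ v → ∀ a b : ℝ, 0 < a → 0 < b → a + b = 1 →
    a • u + b • v ∈ interior C

theorem StrictConvexSet.strictConvex {E : Type*} [AddCommGroup E] [Module ℝ E]
    [TopologicalSpace E] {C : Set E} (hC : StrictConvexSet C) : StrictConvex ℝ C := by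
  intro u hu v hv huv a b ha hb hab
  exact hC hu hv huv a b ha hb hab

/-- Frontier points of a closed strictly convex set are extreme points. -/
theorem StrictConvex.frontier_subset_extremePoints {E : Type*} [AddCommGroup E] [Module ℝ E]
    [TopologicalSpace E] {C : Set E} (hC : StrictConvex ℝ C) (hcl : IsClosed C) :
    frontier C ⊆ C.extremePoints ℝ := by
  intro x hx
  refine mem_extremePoints_iff_left.2 ⟨hcl.frontier_subset hx, fun u hu v hv hxuv => ?_⟩
  by_contra hux
  have huv : u ≠ v := by
    rintro rfl
    rw [openSegment_same] at hxuv
    exact hux hxuv.symm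
  exact hx.2 (hC.openSegment_subset hu hv huv hxuv)

theorem frontier_strictConvex_inter_convexHull
    (n : ℕ) (hn : 1 ≤ n) (V : Finset (Fin n → ℝ)) (hcard : 2 ≤ V.card)
    (hext : ∀ v ∈ V, v ∉ convexHull ℝ (↑(V.erase v) : Set (Fin n → ℝ)))
    (Cs : Set (Fin n → ℝ)) (hcl : IsClosed Cs) (hsc : StrictConvexSet Cs)
    (hV : (V : Set (Fin n → ℝ)) ⊆ frontier Cs) :
    frontier Cs ∩ convexHull ℝ (V : Set (Fin n → ℝ)) = (V : Set (Fin n → ℝ)) := by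
  have hVC : (V : Set (Fin n → ℝ)) ⊆ Cs := hV.trans hcl.frontier_subset
  refine Set.Subset.antisymm ?_ (Set.subset_inter hV (subset_convexHull ℝ _))
  rintro x ⟨hxf, hxV⟩
  exact extremePoints_convexHull_subset <|
    inter_extremePoints_subset_extremePoints_of_subset
      (convexHull_min hVC hsc.strictConvex.convex)
      ⟨hxV, hsc.strictConvex.frontier_subset_extremePoints hcl hxf⟩
end

section
/- (Proposition 3, items 1 and 2.) Fix integers n' ≥ 2 and k with 1 ≤ k ≤ n'−1. Then: (1) the function p_s ↦ T(p_s, k, n') is strictly decreasing on (0, 1/n']; and (2) the image of the interval (0, 1/n'] under p_s ↦ T(p_s, k, n') is exactly the half-open interval [θ_{n'}, θ_{n'−k}). Consequently, for every θ ∈ [θ_{n'}, θ_{n'−k}) there is exactly one p_s ∈ (0, 1/n'] with T(p_s, k, n') = θ. -/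
open scoped BigOperators

/-- The larger contention probability `p_l = (1 - k p_s)/(n' - k)`. -/
noncomputable def plv (ps : ℝ) (k n' : ℕ) : ℝ := (1 - (k : ℝ) * ps) / ((n' : ℝ) - k)

/-- The rate `x_s` of a user contending with probability `p_s`. -/
noncomputable def xsv (ps : ℝ) (k n' : ℕ) : ℝ :=
  ps * (1 - ps) ^ (k - 1) * (1 - plv ps k n') ^ (n' - k)

/-- The rate `x_l` of a user contending with probability `p_l`. -/
noncomputable def xlv (ps : ℝ) (k n' : ℕ) : ℝ :=
  plv ps k n' * (1 - ps) ^ k * (1 - plv ps k n') ^ (n' - k - 1)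

/-- The throughput `T(p_s, k, n') = k x_s + (n'-k) x_l`. -/
noncomputable def Tp (ps : ℝ) (k n' : ℕ) : ℝ :=
  (k : ℝ) * xsv ps k n' + ((n' : ℝ) - k) * xlv ps k n'

theorem Tp_eq (p : ℝ) (a b : ℕ) :
    Tp p (a + 1) (a + b + 2) = (1 - p) ^ a * (1 - plv p (a + 1) (a + b + 2)) ^ b *
      (1 - (a + b + 2) * p * plv p (a + 1) (a + b + 2)) := by
  have hb : (b : ℝ) + 1 ≠ 0 := by positivity
  have hq : ((b : ℝ) + 1) * plv p (a + 1) (a + b + 2) = 1 - (a + 1) * p := by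
    have h : ((a + b + 2 : ℕ) : ℝ) - ((a + 1 : ℕ) : ℝ) = b + 1 := by push_cast; ring
    rw [plv, h]
    push_cast
    field_simp
  have h1 : a + b + 2 - (a + 1) = b + 1 := by omega
  rw [Tp, xsv, xlv, h1]
  generalize plv p (a + 1) (a + b + 2) = q at *
  simp only [Nat.add_sub_cancel, pow_succ]
  push_cast
  linear_combination ((1 - p) ^ a * (1 - q) ^ b) * hq

theorem plv_eq (p : ℝ) (a b : ℕ) :
    plv p (a + 1) (a + b + 2) = (1 - (a + 1) * p) / (b + 1) := by
  have h : ((a + b + 2 : ℕ) : ℝ) - ((a + 1 : ℕ) : ℝ) = b + 1 := by push_cast; ring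
  rw [plv, h]
  push_cast
  rfl

theorem hasDerivAt_Tp (p : ℝ) (a b : ℕ) :
    HasDerivAt (fun p => Tp p (a + 1) (a + b + 2))
      ((-(a * (1 - p) ^ (a - 1)) * (1 - plv p (a + 1) (a + b + 2)) ^ b +
        (1 - p) ^ a * (b * (1 - plv p (a + 1) (a + b + 2)) ^ (b - 1) * ((a + 1) / (b + 1)))) *
          (1 - (a + b + 2) * p * plv p (a + 1) (a + b + 2)) +
        (1 - p) ^ a * (1 - plv p (a + 1) (a + b + 2)) ^ b *
          -((a + b + 2) * (plv p (a + 1) (a + b + 2) - p * ((a + 1) / (b + 1))))) p := by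
  simp only [Tp_eq]
  have hq : HasDerivAt (fun p => plv p (a + 1) (a + b + 2)) (-((a + 1) / (b + 1) : ℝ)) p := by
    simp only [plv_eq]
    refine ((((hasDerivAt_id p).const_mul ((a : ℝ) + 1)).const_sub 1).div_const
      ((b : ℝ) + 1)).congr_deriv ?_
    ring
  have h1 := ((hasDerivAt_id p).const_sub 1).pow a
  have h2 := (hq.const_sub 1).pow b
  have h3 := (((hasDerivAt_id p).const_mul ((a : ℝ) + b + 2)).mul hq).const_sub 1
  refine ((h1.mul h2).mul h3).congr_deriv ?_
  simp only [id, Pi.mul_apply, Pi.pow_apply]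
  ring

theorem deriv_Tp_neg {p : ℝ} (a b : ℕ) (hp : 0 < p) (hp' : p < 1 / ((a : ℝ) + b + 2)) :
    deriv (fun p => Tp p (a + 1) (a + b + 2)) p < 0 := by
  rw [(hasDerivAt_Tp p a b).deriv]
  have ha : (0 : ℝ) ≤ a := a.cast_nonneg
  have hb : (0 : ℝ) ≤ b := b.cast_nonneg
  have hpn : p * (a + b + 2) < 1 := (lt_div_iff₀ (by positivity)).1 hp'
  have hq : ((b : ℝ) + 1) * plv p (a + 1) (a + b + 2) = 1 - (a + 1) * p := by
    rw [plv_eq]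
    field_simp
  generalize plv p (a + 1) (a + b + 2) = q at *
  have hpa : 0 ≤ a * p := by positivity
  have hpq : p < q := by nlinarith
  have hq0 : 0 < q := hp.trans hpq
  have hq1 : q < 1 := by nlinarith
  have hp1 : p < 1 := hpq.trans hq1
  have hd : ((a : ℝ) + 1) * (b + 1) * (q - p) ^ 2 < a + b + 1 := by
    have h1 : ((b : ℝ) + 1) * (q - p) < 1 := by nlinarith
    have h2 : ((b : ℝ) + 1) * (q - p) * (q - p) < 1 := by nlinarith
    nlinarith
  have pow_pred (x : ℝ) (j : ℕ) : j * x ^ (j - 1) * x = j * x ^ j := by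
    cases j with
    | zero => simp
    | succ j => rw [Nat.add_sub_cancel, pow_succ, mul_assoc]
  have hA := pow_pred (1 - p) a
  have hB := pow_pred (1 - q) b
  have hX : 0 < (1 - p) ^ a := pow_pos (by linarith) a
  have hY : 0 < (1 - q) ^ b := pow_pos (by linarith) b
  generalize (1 - p) ^ a = X at *
  generalize (1 - q) ^ b = Y at *
  generalize (1 - p) ^ (a - 1) = X' at *
  generalize (1 - q) ^ (b - 1) = Y' at *
  have key : ((-(a * X') * Y + X * (b * Y' * ((a + 1) / (b + 1)))) * (1 - (a + b + 2) * p * q) +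
      X * Y * -((a + b + 2) * (q - p * ((a + 1) / (b + 1))))) * ((1 - p) * (1 - q)) =
      -(X * Y * ((a + 1) / (a + b + 2)) * (q - p) *
        (a + b + 1 - (a + 1) * (b + 1) * (q - p) ^ 2)) := by
    have e1 : ((-(a * X') * Y + X * (b * Y' * ((a + 1) / (b + 1)))) * (1 - (a + b + 2) * p * q) +
      X * Y * -((a + b + 2) * (q - p * ((a + 1) / (b + 1))))) * ((1 - p) * (1 - q)) =
      X * Y * ((-a * (1 - q) + b * (1 - p) * ((a + 1) / (b + 1))) * (1 - (a + b + 2) * p * q)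
       - ((a + b + 2) * (q - p * ((a + 1) / (b + 1)))) * ((1 - p) * (1 - q))) := by
      linear_combination (-Y * (1 - q) * (1 - (a + b + 2) * p * q)) * hA +
        (X * ((a + 1) / (b + 1)) * (1 - p) * (1 - (a + b + 2) * p * q)) * hB
    have hp2 : p = (1 - (b + 1) * (q - p)) / (a + b + 2) := by
      field_simp
      linear_combination hq
    have hq2 : q = (1 + (a + 1) * (q - p)) / (a + b + 2) := by
      field_simp
      linear_combination hq
    rw [e1]
    generalize q - p = d at *
    subst hp2 hq2
    field_simp
    ring
  have hpos : 0 < (1 - p) * (1 - q) := mul_pos (by linarith) (by linarith)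
  refine neg_of_mul_neg_left ?_ hpos.le
  rw [key, neg_lt_zero]
  have := sub_pos.2 hpq
  have := sub_pos.2 hd
  positivity

theorem Tp_zero (a b : ℕ) : Tp 0 (a + 1) (a + b + 2) = crit (b + 1) := by
  simp [Tp_eq, plv_eq, crit]

theorem Tp_one_div (a b : ℕ) :
    Tp (1 / ((a : ℝ) + b + 2)) (a + 1) (a + b + 2) = crit (a + b + 2) := by
  have hq : plv (1 / ((a : ℝ) + b + 2)) (a + 1) (a + b + 2) = 1 / ((a : ℝ) + b + 2) := by
    rw [plv_eq]
    field_simp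
    ring
  have h1 : a + b + 2 - 1 = a + b + 1 := by omega
  have h2 : ((a : ℝ) + b + 2) * (1 / (a + b + 2)) = 1 := by field_simp
  rw [Tp_eq, hq, crit, h1, h2, pow_succ, pow_add]
  push_cast
  ring

theorem strictAntiOn_Tp (a b : ℕ) :
    StrictAntiOn (fun p => Tp p (a + 1) (a + b + 2)) (Set.Icc 0 (1 / ((a : ℝ) + b + 2))) := by
  refine strictAntiOn_of_deriv_neg (convex_Icc _ _)
    (fun p _ => (hasDerivAt_Tp p a b).continuousAt.continuousWithinAt) fun p hp => ?_
  rw [interior_Icc] at hp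
  exact deriv_Tp_neg a b hp.1 hp.2

theorem throughput_strictAnti_and_range
    (n' k : ℕ) (hn' : 2 ≤ n') (hk : 1 ≤ k) (hk' : k ≤ n' - 1) :
    StrictAntiOn (fun ps => Tp ps k n') (Set.Ioc (0:ℝ) (1 / (n' : ℝ))) ∧
    (fun ps => Tp ps k n') '' Set.Ioc (0:ℝ) (1 / (n' : ℝ)) =
      Set.Ico (crit n') (crit (n' - k)) ∧
    ∀ θ ∈ Set.Ico (crit n') (crit (n' - k)),
      ∃! ps : ℝ, ps ∈ Set.Ioc (0:ℝ) (1 / (n' : ℝ)) ∧ Tp ps k n' = θ := by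
  obtain ⟨a, rfl⟩ : ∃ a, k = a + 1 := ⟨k - 1, by omega⟩
  obtain ⟨b, rfl⟩ : ∃ b, n' = a + b + 2 := ⟨n' - a - 2, by omega⟩
  have hm : a + b + 2 - (a + 1) = b + 1 := by omega
  have hn : ((a + b + 2 : ℕ) : ℝ) = a + b + 2 := by push_cast; rfl
  rw [hm, hn, ← Tp_zero a b, ← Tp_one_div a b]
  have hpos : (0 : ℝ) < 1 / ((a : ℝ) + b + 2) := by positivity
  have hanti := strictAntiOn_Tp a b
  have hsub := hanti.mono Set.Ioc_subset_Icc_self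
  have himage : (fun ps => Tp ps (a + 1) (a + b + 2)) '' Set.Ioc 0 (1 / ((a : ℝ) + b + 2)) =
      Set.Ico (Tp (1 / ((a : ℝ) + b + 2)) (a + 1) (a + b + 2)) (Tp 0 (a + 1) (a + b + 2)) := by
    refine Set.Subset.antisymm ?_ (intermediate_value_Ioc' hpos.le
      fun p _ => (hasDerivAt_Tp p a b).continuousAt.continuousWithinAt)
    rintro _ ⟨p, hp, rfl⟩
    exact ⟨hanti.antitoneOn (Set.Ioc_subset_Icc_self hp) (Set.right_mem_Icc.2 hpos.le) hp.2,
      hanti (Set.left_mem_Icc.2 hpos.le) (Set.Ioc_subset_Icc_self hp) hp.1⟩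
  refine ⟨hsub, himage, fun θ hθ => ?_⟩
  rw [← himage] at hθ
  obtain ⟨p, hp, rfl⟩ := hθ
  exact ⟨p, ⟨hp, rfl⟩, fun y hy => hsub.injOn hy.1 hp hy.2⟩
end

section
/- (Proposition 4, part i: extremizers take at most two nonzero values.) Fix an integer n ≥ 2 and θ ∈ (0,1). (i) Let α ≤ −1, with F_α(x) = (1/(1−α))·∑_{i=1}^n x_i^{1−α}. If p* ∈ [0,1)^n is a global maximizer or a global minimizer of p ↦ F_α(x(p)) over the set {p ∈ [0,1)^n : T(x(p)) = θ}, or over the set {p ∈ [0,1)^n : T(x(p)) ≥ θ}, then the set of distinct nonzero values taken by the components of p* has at most two elements. (ii) Let α ≥ 1, with F_α(x) = ∑_{i=1}^n log x_i if α = 1 and F_α(x) = (1/(1−α))·∑_{i=1}^n x_i^{1−α} if α > 1. If p* ∈ (0,1)^n is a global maximizer of p ↦ F_α(x(p)) over {p ∈ (0,1)^n : T(x(p)) = θ}, or over {p ∈ (0,1)^n : T(x(p)) ≥ θ}, then the components of p* take at most two distinct values. -/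
open scoped BigOperators

/-- The throughput of the rate vector of control `p`. -/
noncomputable def tput {n : ℕ} (p : Fin n → ℝ) : ℝ := ∑ i, rate p i

open scoped Topology

theorem rate_update_self {n : ℕ} (p : Fin n → ℝ) (i : Fin n) (t : ℝ) :
    rate (Function.update p i t) i = t * ∏ j ∈ Finset.univ.erase i, (1 - p j) := by
  unfold rate
  rw [Function.update_self]
  congr 1
  refine Finset.prod_congr rfl fun j hj => ?_
  rw [Function.update_of_ne (Finset.ne_of_mem_erase hj)]

theorem rate_update_of_ne {n : ℕ} (p : Fin n → ℝ) {i j : Fin n} (hij : j ≠ i) (t : ℝ) :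
    rate (Function.update p i t) j =
      (1 - t) * (p j * ∏ k ∈ (Finset.univ.erase j).erase i, (1 - p k)) := by
  unfold rate
  rw [Function.update_of_ne hij,
    ← Finset.mul_prod_erase (Finset.univ.erase j) _ (show i ∈ Finset.univ.erase j by simp [hij.symm]),
    Function.update_self]
  have : ∏ k ∈ (Finset.univ.erase j).erase i, (1 - Function.update p i t k) =
      ∏ k ∈ (Finset.univ.erase j).erase i, (1 - p k) :=
    Finset.prod_congr rfl fun k hk => by
      rw [Function.update_of_ne (Finset.ne_of_mem_erase hk)]
  rw [this]
  ring

theorem one_sub_mul_rate {n : ℕ} (p : Fin n → ℝ) (i : Fin n) :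
    (1 - p i) * rate p i = p i * ∏ j, (1 - p j) := by
  rw [rate, ← Finset.mul_prod_erase Finset.univ _ (Finset.mem_univ i)]
  ring

theorem hasDerivAt_rate_update {n : ℕ} (p : Fin n → ℝ) (i j : Fin n) (hi : p i ≠ 1) :
    HasDerivAt (fun t => rate (Function.update p i t) j)
      (((if j = i then ∏ k, (1 - p k) + rate p i else 0) - rate p j) / (1 - p i)) (p i) := by
  have h1 : 1 - p i ≠ 0 := sub_ne_zero.2 hi.symm
  by_cases hij : j = i
  · subst hij
    simp_rw [rate_update_self]
    refine ((hasDerivAt_id (p j)).mul_const (∏ k ∈ Finset.univ.erase j, (1 - p k))).congr_deriv ?_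
    rw [← Finset.mul_prod_erase Finset.univ _ (Finset.mem_univ j)]
    simp [h1]
  · have hj := rate_update_of_ne p hij (p i)
    rw [Function.update_eq_self] at hj
    simp_rw [rate_update_of_ne p hij]
    refine (((hasDerivAt_id (p i)).const_sub 1).mul_const
      (p j * ∏ k ∈ (Finset.univ.erase j).erase i, (1 - p k))).congr_deriv ?_
    rw [hj, if_neg hij]
    field_simp
    ring

theorem hasDerivAt_sum_rate_update {n : ℕ} (p : Fin n → ℝ) (i : Fin n) (hi : p i ≠ 1)
    {φ : ℝ → ℝ} {d : Fin n → ℝ} (hφ : ∀ j, HasDerivAt φ (d j) (rate p j)) :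
    HasDerivAt (fun t => ∑ j, φ (rate (Function.update p i t) j))
      ((d i * (∏ k, (1 - p k) + rate p i) - ∑ j, d j * rate p j) / (1 - p i)) (p i) := by
  have h : ∀ j, HasDerivAt (fun t => φ (rate (Function.update p i t) j))
      (d j * (((if j = i then ∏ k, (1 - p k) + rate p i else 0) - rate p j) / (1 - p i)))
      (p i) := fun j =>
    (hφ j).comp_of_eq (p i) (hasDerivAt_rate_update p i j hi) (by rw [Function.update_eq_self])
  refine (HasDerivAt.fun_sum fun j (_ : j ∈ Finset.univ) => h j).congr_deriv ?_
  simp_rw [mul_div_assoc', ← Finset.sum_div, mul_sub, Finset.sum_sub_distrib]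
  simp

/-- The coordinates of `v` on the support of `p`, extended by zero. -/
noncomputable def maskBy {n : ℕ} (p v : Fin n → ℝ) : Fin n → ℝ :=
  fun i => if p i = 0 then 0 else v i

theorem maskBy_self {n : ℕ} (p : Fin n → ℝ) : maskBy p p = p := by
  ext i
  by_cases h : p i = 0 <;> simp [maskBy, h]

theorem maskBy_update {n : ℕ} (p : Fin n → ℝ) {i : Fin n} (hi : p i ≠ 0) (t : ℝ) :
    maskBy p (Function.update p i t) = Function.update p i t := by
  ext j
  by_cases hj : j = i
  · subst hj
    simp [maskBy, hi]
  · by_cases h : p j = 0 <;> simp [maskBy, h, hj]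

theorem contDiff_maskBy_apply {n : ℕ} (p : Fin n → ℝ) (i : Fin n) :
    ContDiff ℝ 1 fun v => maskBy p v i := by
  unfold maskBy
  split_ifs <;> fun_prop

theorem contDiff_rate_maskBy {n : ℕ} (p : Fin n → ℝ) (j : Fin n) :
    ContDiff ℝ 1 fun v => rate (maskBy p v) j := by
  unfold rate
  exact (contDiff_maskBy_apply p j).mul
    (contDiff_prod fun k _ => contDiff_const.sub (contDiff_maskBy_apply p k))

theorem exists_hasStrictFDerivAt_sum_rate_maskBy {n : ℕ} (p : Fin n → ℝ)
    {φ : ℝ → ℝ} {d : Fin n → ℝ} (hφ : ∀ j, HasStrictDerivAt φ (d j) (rate p j)) :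
    ∃ L : StrongDual ℝ (Fin n → ℝ),
      HasStrictFDerivAt (fun v => ∑ j, φ (rate (maskBy p v) j)) L p := by
  refine ⟨_, HasStrictFDerivAt.fun_sum fun j (_ : j ∈ Finset.univ) =>
    HasStrictDerivAt.comp_hasStrictFDerivAt_of_eq p (hφ j)
      ((contDiff_rate_maskBy p j).contDiffAt.hasStrictFDerivAt one_ne_zero) ?_⟩
  rw [maskBy_self]

theorem apply_single_of_hasStrictFDerivAt_sum_rate_maskBy {n : ℕ} (p : Fin n → ℝ) (i : Fin n)
    (hi0 : p i ≠ 0) (hi1 : p i ≠ 1) {φ : ℝ → ℝ} {d : Fin n → ℝ}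
    (hφ : ∀ j, HasDerivAt φ (d j) (rate p j)) {L : StrongDual ℝ (Fin n → ℝ)}
    (hL : HasStrictFDerivAt (fun v => ∑ j, φ (rate (maskBy p v) j)) L p) :
    L (Pi.single i 1) =
      (d i * (∏ k, (1 - p k) + rate p i) - ∑ j, d j * rate p j) / (1 - p i) := by
  have h := hL.hasFDerivAt.comp_hasDerivAt_of_eq (p i) (hasDerivAt_update p i (p i))
    (Function.update_eq_self i p).symm
  simp only [Function.comp_def, maskBy_update p hi0] at h
  exact h.unique (hasDerivAt_sum_rate_update p i hi1 hφ)

/-- The Lagrange multiplier rule on the support of an extremizer. -/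
theorem exists_multipliers_of_isExtrOn {n : ℕ} {p : Fin n → ℝ} {J : Set ℝ}
    (hpJ : ∀ i, p i ∈ J) (hJ : ∀ i, p i ≠ 0 → J ∈ 𝓝 (p i)) (hp1 : ∀ i, p i ≠ 1)
    {φ : ℝ → ℝ} {d : Fin n → ℝ} (hφ : ∀ j, HasStrictDerivAt φ (d j) (rate p j))
    (hext : IsExtrOn (fun q => ∑ j, φ (rate q j)) {q | (∀ i, q i ∈ J) ∧ tput q = tput p} p) :
    ∃ a b : ℝ, (a, b) ≠ 0 ∧ ∀ i, p i ≠ 0 →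
      a * (∏ k, (1 - p k) + rate p i - tput p) +
        b * (d i * (∏ k, (1 - p k) + rate p i) - ∑ j, d j * rate p j) = 0 := by
  have hid : ∀ j, HasStrictDerivAt (fun x : ℝ => x) ((fun _ => 1 : Fin n → ℝ) j) (rate p j) :=
    fun j => hasStrictDerivAt_id _
  obtain ⟨L, hL⟩ := exists_hasStrictFDerivAt_sum_rate_maskBy p hφ
  obtain ⟨M, hM⟩ := exists_hasStrictFDerivAt_sum_rate_maskBy p hid
  have hmem : ∀ᶠ v in 𝓝 p, ∀ i, maskBy p v i ∈ J := by
    refine Filter.eventually_all.2 fun i => ?_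
    by_cases hi : p i = 0
    · have := hpJ i
      rw [hi] at this
      simpa [maskBy, hi] using this
    · simp only [maskBy, hi, if_false]
      exact (continuous_apply i).continuousAt.eventually_mem (hJ i hi)
  have hmem' : ∀ᶠ v in 𝓝[{v | ∑ j, rate (maskBy p v) j = ∑ j, rate (maskBy p p) j}] p,
      maskBy p v ∈ {q | (∀ i, q i ∈ J) ∧ tput q = tput p} := by
    filter_upwards [self_mem_nhdsWithin, mem_nhdsWithin_of_mem_nhds hmem] with v h1 h2
    refine ⟨h2, ?_⟩
    rwa [maskBy_self p] at h1
  have hloc : IsLocalExtrOn (fun v => ∑ j, φ (rate (maskBy p v) j))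
      {v | ∑ j, rate (maskBy p v) j = ∑ j, rate (maskBy p p) j} p := by
    refine hext.imp (fun h => ?_) fun h => ?_
    · filter_upwards [hmem'] with v hv
      simpa only [maskBy_self, Set.mem_ofPred_eq] using h hv
    · filter_upwards [hmem'] with v hv
      simpa only [maskBy_self, Set.mem_ofPred_eq] using h hv
  obtain ⟨a, b, hab, h⟩ := hloc.exists_multipliers_of_hasStrictFDerivAt_1d hM hL
  refine ⟨a, b, hab, fun i hi => ?_⟩
  have h0 := DFunLike.congr_fun h (Pi.single i 1)
  have h1 : 1 - p i ≠ 0 := sub_ne_zero.2 (hp1 i).symm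
  simp only [_root_.add_apply, _root_.smul_apply, smul_eq_mul,
    _root_.zero_apply,
    apply_single_of_hasStrictFDerivAt_sum_rate_maskBy p i hi (hp1 i)
      (fun j => (hφ j).hasDerivAt) hL,
    apply_single_of_hasStrictFDerivAt_sum_rate_maskBy p i hi (hp1 i)
      (fun j => (hid j).hasDerivAt) hM, one_mul] at h0
  rw [mul_div_assoc', mul_div_assoc', ← add_div, div_eq_zero_iff] at h0
  exact h0.resolve_right h1

theorem hasStrictDerivAt_Ualpha {α z : ℝ} (h : z ≠ 0 ∨ α ≤ -1) :
    HasStrictDerivAt (Ualpha α) (z ^ (-α)) z := by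
  by_cases hα : α = 1
  · subst hα
    have hz : z ≠ 0 := h.resolve_right (by norm_num)
    have : Ualpha 1 = Real.log := by ext; simp [Ualpha]
    rw [this, Real.rpow_neg_one]
    exact Real.hasStrictDerivAt_log hz
  · have hα' : 1 - α ≠ 0 := sub_ne_zero.2 (Ne.symm hα)
    have hU : Ualpha α = fun z => z ^ (1 - α) / (1 - α) := by ext; simp [Ualpha, hα]
    have hpow : HasStrictDerivAt (fun z : ℝ => z ^ (1 - α)) ((1 - α) * z ^ (1 - α - 1)) z := by
      rcases h with hz | hα1
      · exact Real.hasStrictDerivAt_rpow_const_of_ne hz _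
      · have hc : ContDiffAt ℝ 1 (fun z : ℝ => z ^ (1 - α)) z :=
          (Real.contDiff_rpow_const_of_le (n := 1) (by push_cast; linarith)).contDiffAt
        have hs := hc.hasStrictDerivAt one_ne_zero
        rwa [(Real.hasDerivAt_rpow_const (Or.inr (by linarith))).deriv] at hs
    rw [hU]
    have h := hpow.div_const (1 - α)
    rwa [show 1 - α - 1 = -α by ring, mul_div_cancel_left₀ _ hα'] at h

theorem strictConvexOn_rpow_of_neg {s : ℝ} (hs : s < 0) :
    StrictConvexOn ℝ (Set.Ioi 0) fun x : ℝ => x ^ s := by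
  refine StrictMonoOn.strictConvexOn_of_deriv (convex_Ioi 0)
    (fun x hx => (Real.continuousAt_rpow_const x s (Or.inl (ne_of_gt hx))).continuousWithinAt) ?_
  rw [interior_Ioi]
  intro x hx y hy hxy
  rw [(Real.hasDerivAt_rpow_const (Or.inl (ne_of_gt hx))).deriv,
    (Real.hasDerivAt_rpow_const (Or.inl (ne_of_gt hy))).deriv]
  exact mul_lt_mul_of_neg_left (Real.rpow_lt_rpow_of_neg hx hxy (by linarith)) hs

theorem strictConvexOn_multiplier {α c : ℝ} (hα : α ≤ -1 ∨ 1 ≤ α) (hc : 0 < c) :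
    StrictConvexOn ℝ (Set.Ioi 0) fun x : ℝ => x ^ (1 - α) + c * x ^ (-α) := by
  rcases hα with hα | hα
  · have h1 : StrictConvexOn ℝ (Set.Ioi 0) fun x : ℝ => x ^ (1 - α) :=
      (strictConvexOn_rpow (by linarith)).subset Set.Ioi_subset_Ici_self (convex_Ioi 0)
    have h2 : ConvexOn ℝ (Set.Ioi 0) fun x : ℝ => x ^ (-α) :=
      (convexOn_rpow (by linarith)).subset Set.Ioi_subset_Ici_self (convex_Ioi 0)
    exact h1.add_convexOn (h2.smul hc.le)
  · have h2 : StrictConvexOn ℝ (Set.Ioi 0) fun x : ℝ => c * x ^ (-α) := by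
      have h := strictConvexOn_rpow_of_neg (s := -α) (by linarith)
      refine ⟨h.1, fun x hx y hy hxy a b ha hb hab => ?_⟩
      have := mul_lt_mul_of_pos_left (h.2 hx hy hxy ha hb hab) hc
      simp only [smul_eq_mul] at this ⊢
      linarith
    have h1 : ConvexOn ℝ (Set.Ioi 0) fun x : ℝ => x ^ (1 - α) := by
      rcases hα.eq_or_lt with rfl | hα
      · simpa using convexOn_const (1 : ℝ) (convex_Ioi (0 : ℝ))
      · exact (strictConvexOn_rpow_of_neg (by linarith)).convexOn
    exact h1.add_strictConvexOn h2

/-- A strictly convex function meets a line in at most two points. -/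
theorem StrictConvexOn.not_eq_affine_of_three {s : Set ℝ} {f : ℝ → ℝ} (hf : StrictConvexOn ℝ s f)
    {m c x y z : ℝ} (hx : x ∈ s) (hy : y ∈ s) (hz : z ∈ s)
    (hxy : x ≠ y) (hxz : x ≠ z) (hyz : y ≠ z)
    (fx : f x = m * x + c) (fy : f y = m * y + c) (fz : f z = m * z + c) : False := by
  have key : ∀ {x y z : ℝ}, x ∈ s → z ∈ s → x < y → y < z → f x = m * x + c →
      f y = m * y + c → f z = m * z + c → False := by
    intro x y z hx hz hxy hyz fx fy fz
    have h := hf.slope_strict_mono_adjacent hx hz hxy hyz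
    have e1 : (f y - f x) / (y - x) = m := by
      rw [fx, fy, div_eq_iff (sub_pos.2 hxy).ne']; ring
    have e2 : (f z - f y) / (z - y) = m := by
      rw [fy, fz, div_eq_iff (sub_pos.2 hyz).ne']; ring
    linarith
  rcases lt_or_gt_of_ne hxy with h1 | h1 <;> rcases lt_or_gt_of_ne hxz with h2 | h2 <;>
    rcases lt_or_gt_of_ne hyz with h3 | h3
  · exact key hx hz h1 h3 fx fy fz
  · exact key hx hy h2 h3 fx fz fy
  · linarith
  · exact key hz hy h2 h1 fz fx fy
  · exact key hy hz h1 h2 fy fx fz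
  · linarith
  · exact key hy hx h3 h2 fy fz fx
  · exact key hz hx h3 h1 fz fy fx

theorem card_nonzero_values_le_two {n : ℕ} {α : ℝ} (hα : α ≤ -1 ∨ 1 ≤ α) {p : Fin n → ℝ}
    {J : Set ℝ} (hp0 : ∀ i, 0 ≤ p i) (hp1 : ∀ i, p i < 1) (hαp : α ≤ -1 ∨ ∀ i, p i ≠ 0)
    (hpJ : ∀ i, p i ∈ J) (hJ : ∀ i, p i ≠ 0 → J ∈ 𝓝 (p i))
    (hext : IsExtrOn (fun q => Falpha α (fun i => rate q i))
      {q | (∀ i, q i ∈ J) ∧ tput q = tput p} p) :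
    ((Finset.univ.image p).erase 0).card ≤ 2 := by
  have hπ : 0 < ∏ k, (1 - p k) := Finset.prod_pos fun k _ => sub_pos.2 (hp1 k)
  have hrate : ∀ i, p i ≠ 0 → 0 < rate p i := fun i hi =>
    mul_pos (lt_of_le_of_ne (hp0 i) hi.symm) (Finset.prod_pos fun k _ => sub_pos.2 (hp1 k))
  have hinj : ∀ i j, rate p i = rate p j → p i = p j := by
    intro i j hij
    have hi := one_sub_mul_rate p i
    have hj := one_sub_mul_rate p j
    have hrew : p i * ((1 - p j) * rate p j) = p j * ((1 - p i) * rate p j) := by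
      rw [← hij, hi, hij, hj]
      ring
    by_cases h0 : p i = 0
    · by_contra hne
      have := hrate j (fun h => hne (h0.trans h.symm))
      rw [← hij, rate, h0, zero_mul] at this
      exact this.false
    · have := (hij ▸ hrate i h0).ne'
      apply mul_right_cancel₀ this
      linear_combination hrew
  obtain ⟨a, b, hab, h⟩ := exists_multipliers_of_isExtrOn hpJ hJ (fun i => (hp1 i).ne)
    (d := fun j => rate p j ^ (-α)) (fun j => hasStrictDerivAt_Ualpha
      (hαp.symm.imp_left fun h0 => (hrate j (h0 j)).ne')) hext
  by_contra hcard
  obtain ⟨u, hu, v, hv, w, hw, huv, huw, hvw⟩ := Finset.two_lt_card.1 (not_le.1 hcard)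
  simp only [Finset.mem_erase, Finset.mem_image, Finset.mem_univ, true_and] at hu hv hw
  obtain ⟨hi, i, rfl⟩ := hu
  obtain ⟨hj, j, rfl⟩ := hv
  obtain ⟨hk, k, rfl⟩ := hw
  by_cases hb : b = 0
  · have ha : a ≠ 0 := fun ha => hab (by simp [ha, hb])
    have h1 := h i hi
    have h2 := h j hj
    simp only [hb, zero_mul, add_zero, mul_eq_zero, ha, false_or] at h1 h2
    exact huv (hinj i j (by linarith))
  · have haff : ∀ l, p l ≠ 0 →
        rate p l ^ (1 - α) + (∏ k, (1 - p k)) * rate p l ^ (-α) = -(a / b) * rate p l +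
          (∑ j, rate p j ^ (-α) * rate p j - a / b * (∏ k, (1 - p k) - tput p)) := by
      intro l hl
      have hl' := h l hl
      rw [sub_eq_add_neg, Real.rpow_add (hrate l hl), Real.rpow_one]
      field_simp
      linear_combination hl'
    exact (strictConvexOn_multiplier hα hπ).not_eq_affine_of_three
      (hrate i hi) (hrate j hj) (hrate k hk) (fun e => huv (hinj i j e))
      (fun e => huw (hinj i k e)) (fun e => hvw (hinj j k e)) (haff i hi) (haff j hj) (haff k hk)

theorem extremizers_have_at_most_two_nonzero_values
    (n : ℕ) (hn : 2 ≤ n) (θ : ℝ) (hθ : θ ∈ Set.Ioo (0:ℝ) 1) :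
    -- (i) α ≤ -1, controls in [0,1)^n, maximizers or minimizers, equality or
    -- inequality throughput constraint: at most two distinct nonzero values.
    (∀ α : ℝ, α ≤ -1 → ∀ p : Fin n → ℝ,
      ((p ∈ {q : Fin n → ℝ | (∀ i, q i ∈ Set.Ico (0:ℝ) 1) ∧ tput q = θ} ∧
          (IsMaxOn (fun q => Falpha α (fun i => rate q i))
              {q : Fin n → ℝ | (∀ i, q i ∈ Set.Ico (0:ℝ) 1) ∧ tput q = θ} p ∨
           IsMinOn (fun q => Falpha α (fun i => rate q i))
              {q : Fin n → ℝ | (∀ i, q i ∈ Set.Ico (0:ℝ) 1) ∧ tput q = θ} p)) ∨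
       (p ∈ {q : Fin n → ℝ | (∀ i, q i ∈ Set.Ico (0:ℝ) 1) ∧ θ ≤ tput q} ∧
          (IsMaxOn (fun q => Falpha α (fun i => rate q i))
              {q : Fin n → ℝ | (∀ i, q i ∈ Set.Ico (0:ℝ) 1) ∧ θ ≤ tput q} p ∨
           IsMinOn (fun q => Falpha α (fun i => rate q i))
              {q : Fin n → ℝ | (∀ i, q i ∈ Set.Ico (0:ℝ) 1) ∧ θ ≤ tput q} p))) →
      ((Finset.univ.image p).erase 0).card ≤ 2) ∧
    -- (ii) α ≥ 1, controls in (0,1)^n, maximizers, equality or inequality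
    -- throughput constraint: components take at most two distinct values.
    (∀ α : ℝ, 1 ≤ α → ∀ p : Fin n → ℝ,
      ((p ∈ {q : Fin n → ℝ | (∀ i, q i ∈ Set.Ioo (0:ℝ) 1) ∧ tput q = θ} ∧
          IsMaxOn (fun q => Falpha α (fun i => rate q i))
            {q : Fin n → ℝ | (∀ i, q i ∈ Set.Ioo (0:ℝ) 1) ∧ tput q = θ} p) ∨
       (p ∈ {q : Fin n → ℝ | (∀ i, q i ∈ Set.Ioo (0:ℝ) 1) ∧ θ ≤ tput q} ∧
          IsMaxOn (fun q => Falpha α (fun i => rate q i))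
            {q : Fin n → ℝ | (∀ i, q i ∈ Set.Ioo (0:ℝ) 1) ∧ θ ≤ tput q} p)) →
      (Finset.univ.image p).card ≤ 2) := by
  have key : ∀ (J : Set ℝ) (α : ℝ) (p : Fin n → ℝ),
      ((p ∈ {q : Fin n → ℝ | (∀ i, q i ∈ J) ∧ tput q = θ} ∧
          IsExtrOn (fun q => Falpha α (fun i => rate q i))
            {q : Fin n → ℝ | (∀ i, q i ∈ J) ∧ tput q = θ} p) ∨
       (p ∈ {q : Fin n → ℝ | (∀ i, q i ∈ J) ∧ θ ≤ tput q} ∧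
          IsExtrOn (fun q => Falpha α (fun i => rate q i))
            {q : Fin n → ℝ | (∀ i, q i ∈ J) ∧ θ ≤ tput q} p)) →
      (∀ i, p i ∈ J) ∧ IsExtrOn (fun q => Falpha α (fun i => rate q i))
        {q | (∀ i, q i ∈ J) ∧ tput q = tput p} p := by
    rintro J α p (⟨⟨hpJ, hT⟩, hext⟩ | ⟨⟨hpJ, hT⟩, hext⟩)
    · exact ⟨hpJ, hT ▸ hext⟩
    · exact ⟨hpJ, hext.on_subset fun q hq => ⟨hq.1, hT.trans hq.2.ge⟩⟩
  constructor
  · intro α hα p h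
    obtain ⟨hpJ, hext⟩ := key (Set.Ico 0 1) α p
      (h.imp (And.imp_right Or.symm) (And.imp_right Or.symm))
    exact card_nonzero_values_le_two (Or.inl hα) (fun i => (hpJ i).1) (fun i => (hpJ i).2)
      (Or.inl hα) hpJ
      (fun i hi => Ico_mem_nhds (lt_of_le_of_ne (hpJ i).1 hi.symm) (hpJ i).2) hext
  · intro α hα p h
    obtain ⟨hpJ, hext⟩ := key (Set.Ioo 0 1) α p
      (h.imp (And.imp_right Or.inr) (And.imp_right Or.inr))
    have hcard := card_nonzero_values_le_two (Or.inr hα) (fun i => (hpJ i).1.le)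
      (fun i => (hpJ i).2) (Or.inr fun i => (hpJ i).1.ne') hpJ
      (fun i _ => Ioo_mem_nhds (hpJ i).1 (hpJ i).2) hext
    rwa [Finset.erase_eq_of_notMem] at hcard
    intro h0
    obtain ⟨i, -, hi⟩ := Finset.mem_image.1 h0
    exact (hpJ i).1.ne' hi
end

section
/- (Proposition 4, part ii: two-valued optimizers make the throughput constraint tight.) Fix an integer n ≥ 2 and θ ∈ (0,1). (i) Let α ≤ −1, with F_α(x) = (1/(1−α))·∑_{i=1}^n x_i^{1−α}. If p* ∈ [0,1)^n is a global maximizer or a global minimizer of p ↦ F_α(x(p)) over {p ∈ [0,1)^n : T(x(p)) ≥ θ} and the components of p* take exactly two distinct nonzero values, then T(x(p*)) = θ. (ii) Let α ≥ 1, with F_α(x) = ∑_{i=1}^n log x_i if α = 1 and F_α(x) = (1/(1−α))·∑_{i=1}^n x_i^{1−α} if α > 1. If p* ∈ (0,1)^n is a global maximizer of p ↦ F_α(x(p)) over {p ∈ (0,1)^n : T(x(p)) ≥ θ} and the components of p* take exactly two distinct values, then T(x(p*)) = θ. -/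
open scoped BigOperators

open Function Filter Topology

lemma rate_mul_one_sub {n : ℕ} (p : Fin n → ℝ) (i : Fin n) :
    rate p i * (1 - p i) = p i * ∏ j, (1 - p j) := by
  rw [← Finset.prod_erase_mul _ _ (Finset.mem_univ i), rate, mul_assoc]

lemma rate_update_self_s6 {n : ℕ} (p : Fin n → ℝ) (i : Fin n) (hi : p i ≠ 0) (t : ℝ) :
    rate (update p i t) i = t * (rate p i / p i) := by
  have h : ∏ j ∈ Finset.univ.erase i, (1 - update p i t j) =
      ∏ j ∈ Finset.univ.erase i, (1 - p j) :=
    Finset.prod_congr rfl fun j hj => by rw [update_of_ne (Finset.ne_of_mem_erase hj)]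
  rw [rate, h, update_self, rate]
  field_simp

lemma rate_update_of_ne_s6 {n : ℕ} (p : Fin n → ℝ) {i k : Fin n} (hik : k ≠ i) (hi : 1 - p i ≠ 0)
    (t : ℝ) : rate (update p i t) k = (1 - t) * (rate p k / (1 - p i)) := by
  have hmem : i ∈ Finset.univ.erase k := by simp [hik.symm]
  have h : ∏ j ∈ (Finset.univ.erase k).erase i, (1 - update p i t j) =
      ∏ j ∈ (Finset.univ.erase k).erase i, (1 - p j) :=
    Finset.prod_congr rfl fun j hj => by rw [update_of_ne (Finset.ne_of_mem_erase hj)]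
  rw [rate, rate, ← Finset.mul_prod_erase _ _ hmem, ← Finset.mul_prod_erase _ _ hmem, h,
    update_self, update_of_ne hik]
  field_simp

lemma continuous_tput {n : ℕ} : Continuous (tput : (Fin n → ℝ) → ℝ) := by
  unfold tput rate
  fun_prop

lemma hasDerivAt_Ualpha {α z : ℝ} (h : z ≠ 0 ∨ α ≤ 0) :
    HasDerivAt (Ualpha α) (z ^ (-α)) z := by
  rcases eq_or_ne α 1 with rfl | hα
  · have hz : z ≠ 0 := h.resolve_right (by norm_num)
    have hU : Ualpha 1 = Real.log := by ext; simp [Ualpha]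
    rw [hU, Real.rpow_neg_one]
    exact Real.hasDerivAt_log hz
  · have hU : Ualpha α = fun z => z ^ (1 - α) / (1 - α) := by ext; simp [Ualpha, hα]
    have hα' : 1 - α ≠ 0 := sub_ne_zero.2 hα.symm
    rw [hU]
    have hderiv := (Real.hasDerivAt_rpow_const (x := z) (p := 1 - α)
      (h.imp_right fun h => by linarith)).div_const (1 - α)
    rwa [mul_div_cancel_left₀ _ hα', sub_sub_cancel_left] at hderiv

/-- First-order condition for an extremum of the objective, in the coordinate `i`. -/
lemma utility_eq_of_isExtrOn {n : ℕ} {α : ℝ} {p : Fin n → ℝ} {D : Set (Fin n → ℝ)} {i : Fin n}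
    (hi : p i ∈ Set.Ioo (0 : ℝ) 1) (hrate : ∀ k, rate p k ≠ 0 ∨ α ≤ 0)
    (hext : IsExtrOn (fun q => Falpha α (fun i => rate q i)) D p)
    (hD : ∀ᶠ t in 𝓝 (p i), update p i t ∈ D) :
    rate p i ^ (-α) * rate p i = p i * ∑ k, rate p k ^ (-α) * rate p k := by
  have h0 : p i ≠ 0 := hi.1.ne'
  have h1 : 1 - p i ≠ 0 := (sub_pos.2 hi.2).ne'
  have hloc : IsLocalExtr (fun t => Falpha α (fun k => rate (update p i t) k)) (p i) := by
    rw [← update_eq_self i p] at hext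
    exact IsExtrFilter.comp_tendsto (g := update p i) (b := p i) hext
      (tendsto_principal.2 hD)
  have hderiv_rate : ∀ k, HasDerivAt (fun t => rate (update p i t) k)
      (if k = i then rate p i / p i else -(rate p k / (1 - p i))) (p i) := by
    intro k
    split_ifs with hk
    · subst hk
      simp only [rate_update_self_s6 p k h0]
      simpa using (hasDerivAt_id (p k)).mul_const (rate p k / p k)
    · simp only [rate_update_of_ne_s6 p hk h1]
      simpa using ((hasDerivAt_id (p i)).const_sub 1).mul_const (rate p k / (1 - p i))
  have hderiv : HasDerivAt (fun t => Falpha α (fun k => rate (update p i t) k))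
      (∑ k, rate p k ^ (-α) *
        (if k = i then rate p i / p i else -(rate p k / (1 - p i)))) (p i) := by
    unfold Falpha
    refine HasDerivAt.fun_sum fun k _ => ?_
    refine HasDerivAt.comp (h₂ := Ualpha α) (p i) ?_ (hderiv_rate k)
    rw [update_eq_self]
    exact hasDerivAt_Ualpha (hrate k)
  have hzero := hloc.hasDerivAt_eq_zero hderiv
  rw [← Finset.add_sum_erase _ _ (Finset.mem_univ i)] at hzero ⊢
  rw [if_pos rfl, Finset.sum_congr rfl (g := fun k => rate p k ^ (-α) * rate p k *
    (-(1 / (1 - p i)))) fun k hk => by rw [if_neg (Finset.ne_of_mem_erase hk)]; ring,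
    ← Finset.sum_mul] at hzero
  generalize ∑ k ∈ Finset.univ.erase i, rate p k ^ (-α) * rate p k = s at hzero ⊢
  field_simp at hzero
  linarith

lemma prod_one_sub_pos {n : ℕ} {p : Fin n → ℝ} (hp : ∀ i, p i < 1) : 0 < ∏ j, (1 - p j) :=
  Finset.prod_pos fun j _ => sub_pos.2 (hp j)

lemma rate_pos {n : ℕ} {p : Fin n → ℝ} (hp : ∀ i, p i < 1) {i : Fin n} (hi : 0 < p i) :
    0 < rate p i :=
  mul_pos hi (Finset.prod_pos fun j _ => sub_pos.2 (hp j))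

lemma rate_lt_rate {n : ℕ} {p : Fin n → ℝ} (hp : ∀ i, p i < 1) {i j : Fin n}
    (hi : 0 < p i) (hij : p i < p j) : rate p i < rate p j := by
  have hprod := prod_one_sub_pos hp
  have hri := rate_pos hp hi
  have h := mul_lt_mul_of_pos_right hij hprod
  rw [← rate_mul_one_sub, ← rate_mul_one_sub] at h
  have := hp i
  have := hp j
  by_contra! hle
  nlinarith

/-- The first-order condition forces distinct positive controls to coincide. -/
lemma not_lt_of_utility_eq {n : ℕ} {α : ℝ} {p : Fin n → ℝ} (hp : ∀ i, p i < 1) {i j : Fin n}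
    (hα : α ≤ -1 ∨ 1 ≤ α) {s : ℝ} (hi : 0 < p i)
    (hsi : rate p i ^ (-α) * rate p i = p i * s)
    (hsj : rate p j ^ (-α) * rate p j = p j * s) : ¬ p i < p j := by
  intro hij
  have hri := rate_pos hp hi
  have hlt := rate_lt_rate hp hi hij
  have hrj := hri.trans hlt
  have hsi_pos : 0 < rate p i ^ (-α) * rate p i := mul_pos (Real.rpow_pos_of_pos hri _) hri
  have hs : 0 < s := by
    rw [hsi] at hsi_pos
    exact pos_of_mul_pos_right hsi_pos hi.le
  rcases hα with hα | hα
  · have hpow : rate p i ^ (-α) < rate p j ^ (-α) :=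
      Real.rpow_lt_rpow hri.le hlt (by linarith)
    have hprod := prod_one_sub_pos hp
    have key : ∀ k, 0 < p k → rate p k ^ (-α) * rate p k = p k * s →
        rate p k ^ (-α) * ∏ j, (1 - p j) = (1 - p k) * s := fun k hk h =>
      mul_left_cancel₀ hk.ne' (by
        linear_combination (1 - p k) * h - rate p k ^ (-α) * rate_mul_one_sub p k)
    have hki := key i hi hsi
    have hkj := key j (hi.trans hij) hsj
    nlinarith
  · have hpow : rate p j ^ (1 - α) ≤ rate p i ^ (1 - α) :=
      Real.rpow_le_rpow_of_nonpos hri hlt.le (by linarith)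
    have hrpow : ∀ x : ℝ, 0 < x → x ^ (1 - α) = x ^ (-α) * x := fun x hx => by
      rw [sub_eq_neg_add, Real.rpow_add hx, Real.rpow_one]
    rw [hrpow _ hri, hrpow _ hrj, hsi, hsj] at hpow
    nlinarith

lemma tput_eq_of_isExtrOn {n : ℕ} {α θ : ℝ} {p : Fin n → ℝ} {I : Set ℝ}
    (hI : Set.Ioo 0 1 ⊆ I) (hα : α ≤ -1 ∨ 1 ≤ α)
    (hp : ∀ i, p i ∈ I) (hp1 : ∀ i, p i < 1) (hrate : ∀ k, rate p k ≠ 0 ∨ α ≤ 0)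
    (hθ : θ ≤ tput p)
    (hext : IsExtrOn (fun q => Falpha α (fun i => rate q i))
      {q : Fin n → ℝ | (∀ i, q i ∈ I) ∧ θ ≤ tput q} p)
    {i j : Fin n} (hi : 0 < p i) (hj : 0 < p j) (hij : p i ≠ p j) : tput p = θ := by
  by_contra hne
  have hlt : θ < tput p := lt_of_le_of_ne hθ (Ne.symm hne)
  have hfoc : ∀ k, 0 < p k →
      rate p k ^ (-α) * rate p k = p k * ∑ l, rate p l ^ (-α) * rate p l := by
    intro k hk
    have hk' : p k ∈ Set.Ioo (0 : ℝ) 1 := ⟨hk, hp1 k⟩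
    refine utility_eq_of_isExtrOn hk' hrate hext ?_
    have hcont : Continuous fun t => tput (update p k t) :=
      continuous_tput.comp (continuous_const.update k continuous_id)
    have hev : ∀ᶠ t in 𝓝 (p k), θ < tput (update p k t) :=
      hcont.continuousAt.eventually_const_lt (by simpa using hlt)
    filter_upwards [hev, isOpen_Ioo.mem_nhds hk'] with t ht htI
    refine ⟨fun l => ?_, ht.le⟩
    rcases eq_or_ne l k with rfl | hl
    · simpa using hI htI
    · simpa [hl] using hp l
  rcases hij.lt_or_gt with h | h
  · exact not_lt_of_utility_eq hp1 hα hi (hfoc i hi) (hfoc j hj) h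
  · exact not_lt_of_utility_eq hp1 hα hj (hfoc j hj) (hfoc i hi) h

theorem two_valued_optimizers_make_constraint_tight
    (n : ℕ) (hn : 2 ≤ n) (θ : ℝ) (hθ : θ ∈ Set.Ioo (0:ℝ) 1) :
    -- (i) α ≤ -1, controls in [0,1)^n, global max or min over the throughput
    -- inequality-constrained set, exactly two distinct nonzero values.
    (∀ α : ℝ, α ≤ -1 → ∀ p : Fin n → ℝ,
      p ∈ {q : Fin n → ℝ | (∀ i, q i ∈ Set.Ico (0:ℝ) 1) ∧ θ ≤ tput q} →
      (IsMaxOn (fun q => Falpha α (fun i => rate q i))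
          {q : Fin n → ℝ | (∀ i, q i ∈ Set.Ico (0:ℝ) 1) ∧ θ ≤ tput q} p ∨
       IsMinOn (fun q => Falpha α (fun i => rate q i))
          {q : Fin n → ℝ | (∀ i, q i ∈ Set.Ico (0:ℝ) 1) ∧ θ ≤ tput q} p) →
      ((Finset.univ.image p).erase 0).card = 2 →
      tput p = θ) ∧
    -- (ii) α ≥ 1, controls in (0,1)^n, global max over the throughput
    -- inequality-constrained set, exactly two distinct values.
    (∀ α : ℝ, 1 ≤ α → ∀ p : Fin n → ℝ,
      p ∈ {q : Fin n → ℝ | (∀ i, q i ∈ Set.Ioo (0:ℝ) 1) ∧ θ ≤ tput q} →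
      IsMaxOn (fun q => Falpha α (fun i => rate q i))
          {q : Fin n → ℝ | (∀ i, q i ∈ Set.Ioo (0:ℝ) 1) ∧ θ ≤ tput q} p →
      (Finset.univ.image p).card = 2 →
      tput p = θ) := by
  refine ⟨fun α hα p hp hext hcard => ?_, fun α hα p hp hmax hcard => ?_⟩
  · obtain ⟨a, ha, b, hb, hab⟩ := Finset.one_lt_card.1 (by rw [hcard]; norm_num :
      1 < ((Finset.univ.image p).erase 0).card)
    simp only [Finset.mem_erase, Finset.mem_image, Finset.mem_univ, true_and] at ha hb
    obtain ⟨ha0, i, rfl⟩ := ha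
    obtain ⟨hb0, j, rfl⟩ := hb
    exact tput_eq_of_isExtrOn Set.Ioo_subset_Ico_self (Or.inl hα) hp.1 (fun k => (hp.1 k).2)
      (fun k => Or.inr (by linarith)) hp.2 hext.symm
      (lt_of_le_of_ne (hp.1 i).1 ha0.symm) (lt_of_le_of_ne (hp.1 j).1 hb0.symm) hab
  · obtain ⟨a, ha, b, hb, hab⟩ := Finset.one_lt_card.1 (by rw [hcard]; norm_num :
      1 < (Finset.univ.image p).card)
    simp only [Finset.mem_image, Finset.mem_univ, true_and] at ha hb
    obtain ⟨i, rfl⟩ := ha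
    obtain ⟨j, rfl⟩ := hb
    have hp1 : ∀ k, p k < 1 := fun k => (hp.1 k).2
    exact tput_eq_of_isExtrOn subset_rfl (Or.inr hα) hp.1 hp1
      (fun k => Or.inl (rate_pos hp1 (hp.1 k).1).ne') hp.2 (Or.inr hmax)
      (hp.1 i).1 (hp.1 j).1 hab
end

section
/- (Proposition 5: Jain throughput–fairness tradeoff for n = 2.) Let n = 2 and θ ∈ (0,1). The maximum of F_J(x(p)) over all p ∈ [0,1]² with x_1(p) + x_2(p) = θ is attained, and it equals 1 if θ ∈ (0, 1/2], and equals θ²/(θ² + 2θ − 1) if θ ∈ (1/2, 1). -/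
open scoped BigOperators

theorem rate_two_zero (p : Fin 2 → ℝ) : rate p 0 = p 0 * (1 - p 1) := by
  have h : (Finset.univ.erase (0 : Fin 2)) = {1} := by decide
  simp [rate, h]

theorem rate_two_one (p : Fin 2 → ℝ) : rate p 1 = p 1 * (1 - p 0) := by
  have h : (Finset.univ.erase (1 : Fin 2)) = {0} := by decide
  simp [rate, h]

theorem tput_two (p : Fin 2 → ℝ) : tput p = p 0 + p 1 - 2 * p 0 * p 1 := by
  rw [tput, Fin.sum_univ_two, rate_two_zero, rate_two_one]
  ring

theorem jain_rate_two (p : Fin 2 → ℝ) :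
    jain (fun i => rate p i) = tput p ^ 2 / (tput p ^ 2 + (p 0 - p 1) ^ 2) := by
  rw [jain, tput, Fin.sum_univ_two, Fin.sum_univ_two, rate_two_zero, rate_two_one]
  congr 1
  push_cast
  ring

/-- The squared difference of the two controls is at least `2 * tput p - 1`. -/
theorem two_mul_tput_sub_one_le (p : Fin 2 → ℝ) : 2 * tput p - 1 ≤ (p 0 - p 1) ^ 2 := by
  rw [tput_two]
  nlinarith [sq_nonneg (1 - p 0 - p 1)]

theorem jain_tradeoff_two_users (θ : ℝ) (hθ : θ ∈ Set.Ioo (0:ℝ) 1) :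
    ∃ p : Fin 2 → ℝ, (∀ i, p i ∈ Set.Icc (0:ℝ) 1) ∧ tput p = θ ∧
      (∀ q : Fin 2 → ℝ, (∀ i, q i ∈ Set.Icc (0:ℝ) 1) → tput q = θ →
        jain (fun i => rate q i) ≤ jain (fun i => rate p i)) ∧
      (θ ≤ 1/2 → jain (fun i => rate p i) = 1) ∧
      (1/2 < θ → jain (fun i => rate p i) = θ^2 / (θ^2 + 2*θ - 1)) := by
  obtain ⟨h0, h1⟩ := hθ
  have hpos : 0 < θ ^ 2 := by positivity
  rcases le_or_gt θ (1 / 2) with h | h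
  · set r := √(1 - 2 * θ)
    have hr : r ^ 2 = 1 - 2 * θ := Real.sq_sqrt (by linarith)
    have hr0 : 0 ≤ r := Real.sqrt_nonneg _
    have hr1 : r ≤ 1 := by nlinarith
    have ht : tput ![(1 - r) / 2, (1 - r) / 2] = θ := by
      rw [tput_two]
      simp only [Matrix.cons_val_zero, Matrix.cons_val_one]
      linarith
    have hj : jain (fun i => rate ![(1 - r) / 2, (1 - r) / 2] i) = 1 := by
      rw [jain_rate_two, ht]
      simp [hpos.ne']
    refine ⟨_, ?_, ht, fun q _ hq => ?_, fun _ => hj, fun h' => absurd h h'.not_ge⟩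
    · refine Fin.forall_fin_two.2 ⟨?_, ?_⟩ <;> constructor <;> simp <;> linarith
    · rw [hj, jain_rate_two, hq]
      exact div_le_one_of_le₀ (by nlinarith [sq_nonneg (q 0 - q 1)]) (by positivity)
  · set d := √(2 * θ - 1)
    have hd : d ^ 2 = 2 * θ - 1 := Real.sq_sqrt (by linarith)
    have hd0 : 0 ≤ d := Real.sqrt_nonneg _
    have hd1 : d ≤ 1 := by nlinarith
    have ht : tput ![(1 + d) / 2, (1 - d) / 2] = θ := by
      rw [tput_two]
      simp only [Matrix.cons_val_zero, Matrix.cons_val_one]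
      linarith
    have hj : jain (fun i => rate ![(1 + d) / 2, (1 - d) / 2] i)
        = θ ^ 2 / (θ ^ 2 + 2 * θ - 1) := by
      rw [jain_rate_two, ht]
      congr 1
      simp only [Matrix.cons_val_zero, Matrix.cons_val_one]
      linarith
    refine ⟨_, ?_, ht, fun q _ hq => ?_, fun h' => absurd h h'.not_gt, fun _ => hj⟩
    · refine Fin.forall_fin_two.2 ⟨?_, ?_⟩ <;> constructor <;> simp <;> linarith
    · have hle := two_mul_tput_sub_one_le q
      rw [hj, jain_rate_two, hq]
      rw [hq] at hle
      exact div_le_div_of_nonneg_left hpos.le (by linarith) (by linarith)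
end

section
/- (Proposition 6: monotonicity of the Jain objective under the throughput constraint.) Fix θ ∈ (0,1). (1) If n' ≥ 3, 1 ≤ k ≤ n'−2, and p_s, p_s' ∈ (0, 1/n') satisfy T(p_s, k, n') = θ and T(p_s', k+1, n') = θ, then F_{−1}(p_s, k, n') < F_{−1}(p_s', k+1, n'). (2) If n' ≥ 2, 1 ≤ k ≤ n'−1, and p_s ∈ (0, 1/n') and p_s'' ∈ (0, 1/(n'+1)) satisfy T(p_s, k, n') = θ and T(p_s'', k+1, n'+1) = θ, then F_{−1}(p_s, k, n') < F_{−1}(p_s'', k+1, n'+1). -/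
open scoped BigOperators

/-- Half the sum of squared rates, `F_{-1}(p_s,k,n') = (1/2)(k x_s² + (n'-k) x_l²)`. -/
noncomputable def Fm1 (ps : ℝ) (k n' : ℕ) : ℝ :=
  (1/2) * ((k : ℝ) * (xsv ps k n') ^ 2 + ((n' : ℝ) - k) * (xlv ps k n') ^ 2)

open Filter Topology Set

/-- Solutions of `f (x, z) = θ` with `z` in a moving compact interval depend continuously on `x`
as long as they are unique. -/
lemma continuousOn_of_unique_solution {f : ℝ × ℝ → ℝ} {lo hi y : ℝ → ℝ} {s : Set ℝ} {θ : ℝ}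
    (hf : Continuous f) (hlo : Continuous lo) (hhi : Continuous hi)
    (hy : ∀ x ∈ s, y x ∈ Icc (lo x) (hi x)) (hfy : ∀ x ∈ s, f (x, y x) = θ)
    (hinj : ∀ x ∈ s, InjOn (fun z => f (x, z)) (Icc (lo x) (hi x))) :
    ContinuousOn y s := by
  intro x₀ hx₀
  have hs : ∀ᶠ x in 𝓝[s] x₀, x ∈ s := self_mem_nhdsWithin
  have hlo₀ : ∀ᶠ x in 𝓝[s] x₀, lo x₀ - 1 < lo x :=
    (hlo.tendsto x₀ |>.mono_left nhdsWithin_le_nhds).eventually (lt_mem_nhds (by linarith))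
  have hhi₀ : ∀ᶠ x in 𝓝[s] x₀, hi x < hi x₀ + 1 :=
    (hhi.tendsto x₀ |>.mono_left nhdsWithin_le_nhds).eventually (gt_mem_nhds (by linarith))
  refine (isCompact_Icc (a := lo x₀ - 1) (b := hi x₀ + 1)).tendsto_nhds_of_unique_mapClusterPt
    ?_ ?_
  · filter_upwards [hs, hlo₀, hhi₀] with x hx h1 h2
    exact ⟨h1.le.trans (hy x hx).1, (hy x hx).2.trans h2.le⟩
  · intro z _ hz
    obtain ⟨U, hU, hUz⟩ := mapClusterPt_iff_ultrafilter.1 hz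
    have hx : Tendsto id (U : Filter ℝ) (𝓝 x₀) := hU.trans nhdsWithin_le_nhds
    have hsU := hU hs
    have hz₁ : lo x₀ ≤ z := le_of_tendsto_of_tendsto ((hlo.tendsto x₀).comp hx) hUz <| by
      filter_upwards [hsU] with x hx using (hy x hx).1
    have hz₂ : z ≤ hi x₀ := le_of_tendsto_of_tendsto hUz ((hhi.tendsto x₀).comp hx) <| by
      filter_upwards [hsU] with x hx using (hy x hx).2
    have hz₃ : f (x₀, z) = θ := by
      refine tendsto_nhds_unique ((hf.tendsto (x₀, z)).comp (hx.prodMk_nhds hUz))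
        (tendsto_const_nhds.congr' ?_)
      filter_upwards [hsU] with x hx using (hfy x hx).symm
    exact hinj x₀ hx₀ ⟨hz₁, hz₂⟩ (hy x₀ hx₀) (hz₃.trans (hfy x₀ hx₀).symm)

/-- Comparison of a function `g` at two points of a level curve of `f`, from the sign of the
derivative of `g` in the direction tangent to the curve. -/
lemma lt_of_level_curve {f g : ℝ × ℝ → ℝ} {lo hi : ℝ → ℝ} {a b θ ya yb : ℝ} (hab : a < b)
    (hf : ContDiff ℝ 1 f) (hg : ContDiff ℝ 1 g) (hlo : Continuous lo) (hhi : Continuous hi)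
    (hle : ∀ x ∈ Ioo a b, lo x ≤ hi x)
    (hflo : ∀ x ∈ Ioo a b, θ < f (x, lo x)) (hfhi : ∀ x ∈ Ioo a b, f (x, hi x) < θ)
    (hfz : ∀ x ∈ Icc a b, ∀ z ∈ Ioo (lo x) (hi x), fderiv ℝ f (x, z) (0, 1) < 0)
    (hslope : ∀ x ∈ Ioo a b, ∀ z ∈ Ioo (lo x) (hi x), ∀ s,
      fderiv ℝ f (x, z) (1, s) = 0 → 0 < fderiv ℝ g (x, z) (1, s))
    (hya : ya ∈ Icc (lo a) (hi a)) (hfa : f (a, ya) = θ)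
    (hyb : yb ∈ Icc (lo b) (hi b)) (hfb : f (b, yb) = θ) :
    g (a, ya) < g (b, yb) := by
  have hinj : ∀ x ∈ Icc a b, InjOn (fun z => f (x, z)) (Icc (lo x) (hi x)) := by
    intro x hx
    refine (strictAntiOn_of_deriv_neg (convex_Icc _ _)
      (hf.continuous.comp (by fun_prop)).continuousOn ?_).injOn
    intro z hz
    rw [interior_Icc] at hz
    exact (((hf.differentiable (by simp)) (x, z)).hasFDerivAt.comp_hasDerivAt z
      ((hasDerivAt_const z x).prodMk (hasDerivAt_id z))).deriv.trans_lt (hfz x hx z hz)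
  have hex : ∀ x, ∃ z, x ∈ Icc a b → z ∈ Icc (lo x) (hi x) ∧ f (x, z) = θ := by
    intro x
    by_cases hx : x ∈ Icc a b
    · rcases eq_or_lt_of_le hx.1 with rfl | h1
      · exact ⟨ya, fun _ => ⟨hya, hfa⟩⟩
      rcases eq_or_lt_of_le hx.2 with rfl | h2
      · exact ⟨yb, fun _ => ⟨hyb, hfb⟩⟩
      obtain ⟨z, hz, hz'⟩ := intermediate_value_Icc' (hle x ⟨h1, h2⟩)
        (f := fun z => f (x, z)) (hf.continuous.comp (by fun_prop)).continuousOn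
        ⟨(hfhi x ⟨h1, h2⟩).le, (hflo x ⟨h1, h2⟩).le⟩
      exact ⟨z, fun _ => ⟨hz, hz'⟩⟩
    · exact ⟨0, fun h => absurd h hx⟩
  choose y hy using hex
  have hyc : ContinuousOn y (Icc a b) := continuousOn_of_unique_solution hf.continuous hlo hhi
    (fun x hx => (hy x hx).1) (fun x hx => (hy x hx).2) hinj
  have ha : a ∈ Icc a b := left_mem_Icc.2 hab.le
  have hb : b ∈ Icc a b := right_mem_Icc.2 hab.le
  have hya' : y a = ya := hinj a ha (hy a ha).1 hya ((hy a ha).2.trans hfa.symm)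
  have hyb' : y b = yb := hinj b hb (hy b hb).1 hyb ((hy b hb).2.trans hfb.symm)
  have hmono : StrictMonoOn (fun x => g (x, y x)) (Icc a b) := by
    refine strictMonoOn_of_deriv_pos (convex_Icc _ _)
      (hg.continuous.comp_continuousOn (continuousOn_id.prodMk hyc)) ?_
    intro x hx
    rw [interior_Icc] at hx
    have hx' := Ioo_subset_Icc_self hx
    have hyx : y x ∈ Ioo (lo x) (hi x) := by
      obtain ⟨⟨h1, h2⟩, h3⟩ := hy x hx'
      refine ⟨lt_of_le_of_ne h1 ?_, lt_of_le_of_ne h2 ?_⟩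
      · intro h
        have := hflo x hx
        rw [h, h3] at this
        exact lt_irrefl _ this
      · intro h
        have := hfhi x hx
        rw [← h, h3] at this
        exact lt_irrefl _ this
    have hfx := hfz x hx' _ hyx
    have hstrict : HasStrictFDerivAt f (fderiv ℝ f (x, y x)) (x, y x) :=
      hf.contDiffAt.hasStrictFDerivAt (by simp)
    have hinv : (fderiv ℝ f (x, y x) ∘L .inr ℝ ℝ ℝ).IsInvertible := by
      refine ⟨ContinuousLinearEquiv.unitsEquivAut ℝ (Units.mk0 _ hfx.ne), ?_⟩
      ext
      simp
    have hev := hstrict.eventually_apply_eq_iff_implicitFunctionOfProdDomain hinv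
    have hnear : Tendsto (fun t => (t, y t)) (𝓝 x) (𝓝 (x, y x)) :=
      tendsto_id.prodMk_nhds (hyc.continuousAt (Icc_mem_nhds hx.1 hx.2))
    have heq : y =ᶠ[𝓝 x] hstrict.implicitFunctionOfProdDomain hinv := by
      filter_upwards [hnear.eventually hev, Icc_mem_nhds hx.1 hx.2] with t ht ht'
      exact (ht.1 ((hy t ht').2.trans (hy x hx').2.symm)).symm
    have hder : HasDerivAt y (deriv y x) x :=
      ((hstrict.hasStrictFDerivAt_implicitFunctionOfProdDomain
        hinv).hasFDerivAt.differentiableAt.congr_of_eventuallyEq heq).hasDerivAt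
    have hcurve := (hasDerivAt_id x).prodMk hder
    have hF := ((hf.differentiable (by simp)) (x, y x)).hasFDerivAt.comp_hasDerivAt x hcurve
    have hG := ((hg.differentiable (by simp)) (x, y x)).hasFDerivAt.comp_hasDerivAt x hcurve
    have hzero : fderiv ℝ f (x, y x) (1, deriv y x) = 0 := by
      refine hF.unique ((hasDerivAt_const x θ).congr_of_eventuallyEq ?_)
      filter_upwards [Icc_mem_nhds hx.1 hx.2] with t ht using (hy t ht).2
    exact (hslope x hx _ hyx _ hzero).trans_eq hG.deriv.symm
  simpa [hya', hyb'] using hmono ha hb hab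

/-- The throughput of a control with `K + 1` components `u`, one component `y` and `M + 1`
components `v`. -/
noncomputable def rateSum (K M : ℕ) (u y v : ℝ) : ℝ :=
  (1 - u) ^ K * (1 - v) ^ M * ((K + 1) * (u * (1 - y) * (1 - v)) + y * (1 - u) * (1 - v)
    + (M + 1) * (v * (1 - u) * (1 - y)))

/-- Half the sum of the squared rates of a control with `K + 1` components `u`, one component `y`
and `M + 1` components `v`. -/
noncomputable def halfSqRateSum (K M : ℕ) (u y v : ℝ) : ℝ :=
  1 / 2 * (((1 - u) ^ K * (1 - v) ^ M) ^ 2 * ((K + 1) * (u * (1 - y) * (1 - v)) ^ 2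
    + (y * (1 - u) * (1 - v)) ^ 2 + (M + 1) * (v * (1 - u) * (1 - y)) ^ 2))

/-- The odds `p / (1 - p)` of a probability `p`. -/
noncomputable def odds (p : ℝ) : ℝ := p / (1 - p)

/-- The probability that no component of the control of `rateSum` is active. -/
noncomputable def idleProb (K M : ℕ) (u y v : ℝ) : ℝ :=
  (1 - u) ^ (K + 1) * (1 - y) * (1 - v) ^ (M + 1)

/-- The sum of the odds of the components of the control of `rateSum`. -/
noncomputable def oddsSum (K M : ℕ) (u y v : ℝ) : ℝ :=
  (K + 1) * odds u + odds y + (M + 1) * odds v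

/-- The sum of the squared odds of the components of the control of `rateSum`. -/
noncomputable def oddsSqSum (K M : ℕ) (u y v : ℝ) : ℝ :=
  (K + 1) * odds u ^ 2 + odds y ^ 2 + (M + 1) * odds v ^ 2

lemma hasDerivAt_one_sub_pow {u : ℝ → ℝ} {u' t : ℝ} (hu : HasDerivAt u u' t) (h : u t ≠ 1)
    (K : ℕ) : HasDerivAt (fun s => (1 - u s) ^ K) (-(K * (1 - u t) ^ K / (1 - u t) * u')) t := by
  have h1 : 1 - u t ≠ 0 := sub_ne_zero.2 h.symm
  refine ((hu.const_sub 1).fun_pow K).congr_deriv ?_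
  cases K with
  | zero => simp
  | succ n => rw [Nat.add_sub_cancel, pow_succ]; field_simp

lemma hasDerivAt_rateSum {K M : ℕ} {u y v : ℝ → ℝ} {u' y' v' t : ℝ} (hu : HasDerivAt u u' t)
    (hy : HasDerivAt y y' t) (hv : HasDerivAt v v' t) (hu1 : u t ≠ 1) (hy1 : y t ≠ 1)
    (hv1 : v t ≠ 1) :
    HasDerivAt (fun s => rateSum K M (u s) (y s) (v s))
      (idleProb K M (u t) (y t) (v t) *
        ((K + 1) * u' * ((1 + odds (u t)) ^ 2
            - oddsSum K M (u t) (y t) (v t) * (1 + odds (u t)))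
          + y' * ((1 + odds (y t)) ^ 2 - oddsSum K M (u t) (y t) (v t) * (1 + odds (y t)))
          + (M + 1) * v' * ((1 + odds (v t)) ^ 2
            - oddsSum K M (u t) (y t) (v t) * (1 + odds (v t))))) t := by
  have h1 : 1 - u t ≠ 0 := sub_ne_zero.2 hu1.symm
  have h2 : 1 - y t ≠ 0 := sub_ne_zero.2 hy1.symm
  have h3 : 1 - v t ≠ 0 := sub_ne_zero.2 hv1.symm
  have hA := hasDerivAt_one_sub_pow hu hu1 K
  have hB := hasDerivAt_one_sub_pow hv hv1 M
  refine ((hA.fun_mul hB).fun_mul (((((hu.fun_mul (hy.const_sub 1)).fun_mul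
    (hv.const_sub 1)).const_mul ((K : ℝ) + 1)).fun_add ((hy.fun_mul (hu.const_sub 1)).fun_mul
    (hv.const_sub 1))).fun_add (((hv.fun_mul (hu.const_sub 1)).fun_mul
    (hy.const_sub 1)).const_mul ((M : ℝ) + 1)))).congr_deriv ?_
  simp only [idleProb, oddsSum, odds, pow_succ _ K, pow_succ _ M]
  field_simp
  ring

lemma hasDerivAt_halfSqRateSum {K M : ℕ} {u y v : ℝ → ℝ} {u' y' v' t : ℝ}
    (hu : HasDerivAt u u' t) (hy : HasDerivAt y y' t) (hv : HasDerivAt v v' t) (hu1 : u t ≠ 1)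
    (hy1 : y t ≠ 1) (hv1 : v t ≠ 1) :
    HasDerivAt (fun s => halfSqRateSum K M (u s) (y s) (v s))
      (idleProb K M (u t) (y t) (v t) ^ 2 *
        ((K + 1) * u' * ((1 + odds (u t)) ^ 3 - (1 + odds (u t)) ^ 2
            - oddsSqSum K M (u t) (y t) (v t) * (1 + odds (u t)))
          + y' * ((1 + odds (y t)) ^ 3 - (1 + odds (y t)) ^ 2
            - oddsSqSum K M (u t) (y t) (v t) * (1 + odds (y t)))
          + (M + 1) * v' * ((1 + odds (v t)) ^ 3 - (1 + odds (v t)) ^ 2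
            - oddsSqSum K M (u t) (y t) (v t) * (1 + odds (v t))))) t := by
  have h1 : 1 - u t ≠ 0 := sub_ne_zero.2 hu1.symm
  have h2 : 1 - y t ≠ 0 := sub_ne_zero.2 hy1.symm
  have h3 : 1 - v t ≠ 0 := sub_ne_zero.2 hv1.symm
  have hA := hasDerivAt_one_sub_pow hu hu1 K
  have hB := hasDerivAt_one_sub_pow hv hv1 M
  refine ((((hA.fun_mul hB).fun_pow 2).fun_mul ((((((hu.fun_mul (hy.const_sub 1)).fun_mul
    (hv.const_sub 1)).fun_pow 2).const_mul ((K : ℝ) + 1)).fun_add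
    (((hy.fun_mul (hu.const_sub 1)).fun_mul (hv.const_sub 1)).fun_pow 2)).fun_add
    ((((hv.fun_mul (hu.const_sub 1)).fun_mul (hy.const_sub 1)).fun_pow 2).const_mul
    ((M : ℝ) + 1)))).const_mul (1 / 2)).congr_deriv ?_
  simp only [idleProb, oddsSqSum, odds, pow_succ _ K, pow_succ _ M]
  field_simp
  ring

lemma odds_nonneg {p : ℝ} (h0 : 0 ≤ p) (h1 : p < 1) : 0 ≤ odds p :=
  div_nonneg h0 (by linarith)

lemma odds_lt_odds {p q : ℝ} (h : p < q) (h1 : q < 1) : odds p < odds q := by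
  unfold odds
  rw [div_lt_div_iff₀ (by linarith) (by linarith)]
  nlinarith

/-- A bound on the odds of all but one component of each kind. -/
lemma odds_others_le {k m u y v : ℝ} (hk : 0 ≤ k) (hu : 0 ≤ u) (huv : u < v) (hv : v < 1)
    (hsum : (k + 1) * u + y + (m + 1) * v = 1) :
    k * odds u + m * odds v ≤ 1 - (u + y) * (1 + odds v) := by
  have h1 : 0 < 1 - v := by linarith
  have h2 : odds u ≤ u / (1 - v) := by
    unfold odds
    exact div_le_div_of_nonneg_left hu h1 (by linarith)
  have h3 : 1 - (u + y) * (1 + odds v) = k * (u / (1 - v)) + m * odds v := by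
    unfold odds
    field_simp
    linear_combination -hsum
  rw [h3]
  gcongr

lemma odds_add_le {u y v : ℝ} (hu : 0 ≤ u) (hy : 0 ≤ y) (huv : u < v) (hyv : y < v)
    (hv : v < 1) : odds u + odds y ≤ (u + y) * (1 + odds v) := by
  have h1 : 0 < 1 - v := by linarith
  have h2 : (u + y) * (1 + odds v) = u / (1 - v) + y / (1 - v) := by
    unfold odds; field_simp; ring
  rw [h2]
  unfold odds
  gcongr

lemma tangent_factor_pos_of_le_half (K M : ℕ) {u y v : ℝ} (hu : 0 < u) (hy : 0 ≤ y) (huv : u < v)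
    (hyv : y < v) (hv : v < 1) (hsum : (K + 1) * u + y + (M + 1) * v = 1)
    (hhalf : v ≤ 1 / 2) :
    0 < (1 + odds u) * (1 + odds y) + (1 + odds u) * (1 + odds v) + (1 + odds y) * (1 + odds v)
      + oddsSqSum K M u y v - oddsSum K M u y v * (3 + odds u + odds y + odds v)
      + oddsSum K M u y v := by
  have hb := odds_nonneg hu.le (huv.trans hv)
  have hc := odds_nonneg hy (hyv.trans hv)
  have hba := odds_lt_odds huv hv
  have hca := odds_lt_odds hyv hv
  have hK : (0 : ℝ) ≤ K := K.cast_nonneg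
  have hM : (0 : ℝ) ≤ M := M.cast_nonneg
  have hoth := odds_others_le hK hu.le huv hv hsum
  have hadd := odds_add_le hu.le hy huv hyv hv
  have h1v : 0 < 1 - v := by linarith
  have h1u : 0 < 1 - u := by linarith
  have hbu : odds u = u * (1 + odds u) := by unfold odds; field_simp; ring
  have hav : odds v = v * (1 + odds v) := by unfold odds; field_simp; ring
  have hau : (1 + odds v) * (1 - v) = 1 := by unfold odds; field_simp; ring
  unfold oddsSqSum oddsSum
  have ha1 : odds v ≤ 1 := by
    unfold odds
    rw [div_le_one h1v]
    linarith
  set a := odds v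
  set b := odds u
  set c := odds y
  set z := (u + y) * (1 + a) with hz
  have ha0 : 0 ≤ a := hb.trans hba.le
  have hz0 : 0 ≤ z := by positivity
  have hz1 : z ≤ 1 := by nlinarith [mul_nonneg hK hb, mul_nonneg hM ha0]
  have e1 : b * (2 + a - b) ≤ 2 * u * (1 + a) := by
    have : 2 * u * (1 + a) - b * (2 + a - b) = u * ((a - b) * (1 - b)) := by
      linear_combination (-(2 + a - b)) * hbu
    nlinarith [mul_nonneg hu.le (mul_nonneg (sub_nonneg.2 hba.le) (by linarith : 0 ≤ 1 - b))]
  have e2 : K * (b * (2 + a - b)) + 2 * (M * a) ≤ 2 - 2 * z := by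
    have h := mul_le_mul_of_nonneg_left e1 hK
    have : K * (2 * u * (1 + a)) + 2 * (M * (v * (1 + a))) = 2 - 2 * z := by
      rw [hz]
      linear_combination 2 * (1 + a) * hsum + 2 * hau
    rw [← hav] at this
    linarith
  have e3 : (K * b + M * a) * (b + c) ≤ (1 - z) * z :=
    mul_le_mul hoth hadd (by positivity) (by linarith)
  have e4 : a * (b + c) ≤ z := by
    nlinarith [mul_nonneg (sub_nonneg.2 ha1) (add_nonneg hb hc)]
  have e5 : b * c ≤ z ^ 2 / 4 := by nlinarith [sq_nonneg (b - c), add_nonneg hb hc]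
  nlinarith

lemma tangent_factor_pos_of_half_lt (K M : ℕ) {u y v : ℝ} (hu : 0 < u) (hy : 0 ≤ y) (huv : u < v)
    (hyv : y < v) (hv : v < 1) (hsum : (K + 1) * u + y + (M + 1) * v = 1)
    (hhalf : 1 / 2 < v) :
    0 < (1 + odds u) * (1 + odds y) + (1 + odds u) * (1 + odds v) + (1 + odds y) * (1 + odds v)
      + oddsSqSum K M u y v - oddsSum K M u y v * (3 + odds u + odds y + odds v)
      + oddsSum K M u y v := by
  have hb := odds_nonneg hu.le (huv.trans hv)
  have hc := odds_nonneg hy (hyv.trans hv)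
  have hba := odds_lt_odds huv hv
  have hK : (0 : ℝ) ≤ K := K.cast_nonneg
  have h1v : 0 < 1 - v := by linarith
  unfold oddsSqSum oddsSum
  have hM0 : M = 0 := by
    by_contra hne
    have : (1 : ℝ) ≤ M := by exact_mod_cast Nat.one_le_iff_ne_zero.2 hne
    have hMv := mul_nonneg (sub_nonneg.2 this) (by linarith : 0 ≤ v)
    linarith [mul_nonneg hK hu.le]
  subst hM0
  have hKu := mul_nonneg hK hu.le
  push_cast at hsum
  have hbs : odds u ≤ u / v := by
    unfold odds
    gcongr
    linarith
  have hcs : odds y ≤ y / v := by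
    unfold odds
    gcongr
    linarith
  have hv0 : 0 < v := by linarith
  have ht : (K + 1) * odds u + odds y ≤ (1 - v) / v := by
    have : (1 - v) / v = (K + 1) * (u / v) + y / v := by
      field_simp
      linarith
    rw [this]
    gcongr
  have hat : odds v * ((K + 1) * odds u + odds y) ≤ 1 := by
    have : odds v * ((1 - v) / v) = 1 := by unfold odds; field_simp
    exact (mul_le_mul_of_nonneg_left ht (hb.trans hba.le)).trans this.le
  have ht1 : (K + 1) * odds u + odds y < 1 := by
    refine ht.trans_lt ?_
    rw [div_lt_one hv0]
    linarith
  set a := odds v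
  set b := odds u
  set c := odds y
  have e : (K + 1) * b * (2 + c) < 2 := by
    have h' : (K + 1) * b * (2 + c) < (1 - c) * (2 + c) :=
      mul_lt_mul_of_pos_right (by linarith) (by linarith)
    linarith [mul_nonneg hc hc]
  have hid : (1 + b) * (1 + c) + (1 + b) * (1 + a) + (1 + c) * (1 + a)
      + ((K + 1) * b ^ 2 + c ^ 2 + ((0 : ℕ) + 1) * a ^ 2)
      - ((K + 1) * b + c + ((0 : ℕ) + 1) * a) * (3 + b + c + a)
      + ((K + 1) * b + c + ((0 : ℕ) + 1) * a)
      = 3 - a * ((K + 1) * b + c) - (K + 1) * b * (2 + c) + 2 * b := by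
    push_cast
    ring
  rw [hid]
  linarith

/-- The quotient of the determinant with rows `1`, `∇ rateSum`, `∇ halfSqRateSum` by the
Vandermonde determinant is positive. -/
lemma tangent_factor_pos (K M : ℕ) {u y v : ℝ} (hu : 0 < u) (hy : 0 ≤ y) (huv : u < v)
    (hyv : y < v) (hv : v < 1) (hsum : (K + 1) * u + y + (M + 1) * v = 1) :
    0 < (1 + odds u) * (1 + odds y) + (1 + odds u) * (1 + odds v) + (1 + odds y) * (1 + odds v)
      + oddsSqSum K M u y v - oddsSum K M u y v * (3 + odds u + odds y + odds v)
      + oddsSum K M u y v := by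
  rcases le_or_gt v (1 / 2) with h | h
  · exact tangent_factor_pos_of_le_half K M hu hy huv hyv hv hsum h
  · exact tangent_factor_pos_of_half_lt K M hu hy huv hyv hv hsum h

lemma vertex_slope_pos_left (K M : ℕ) {u y v : ℝ} (hu : 0 ≤ u) (hy : 0 ≤ y) (huv : u < v)
    (hyv : y < v) (hv : v < 1) (hsum : (K + 1) * u + y + (M + 1) * v = 1) :
    0 < (1 + odds u) + (1 + odds v) - oddsSum K M u y v := by
  have h1 := odds_others_le K.cast_nonneg hu huv hv hsum
  have h2 := odds_add_le hu hy huv hyv hv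
  have h3 := odds_nonneg hu (huv.trans hv)
  unfold oddsSum
  linarith

lemma vertex_slope_pos_right (K M : ℕ) {u y v : ℝ} (hu : 0 ≤ u) (hy : 0 ≤ y) (huv : u < v)
    (hyv : y < v) (hv : v < 1) (hsum : (K + 1) * u + y + (M + 1) * v = 1) :
    0 < (1 + odds y) + (1 + odds v) - oddsSum K M u y v := by
  have h1 := odds_others_le K.cast_nonneg hu huv hv hsum
  have h2 := odds_add_le hu hy huv hyv hv
  have h3 := odds_nonneg hy (hyv.trans hv)
  unfold oddsSum
  linarith

/-- The value `v` that makes `(K + 1) u + y + (M + 1) v = 1`. -/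
noncomputable def complementProb (K M : ℕ) (u y : ℝ) : ℝ := (1 - (K + 1) * u - y) / (M + 1)

lemma complementProb_sum (K M : ℕ) (u y : ℝ) :
    (K + 1) * u + y + (M + 1) * complementProb K M u y = 1 := by
  unfold complementProb
  field_simp
  ring

lemma lt_complementProb_iff {K M : ℕ} {u y x : ℝ} :
    x < complementProb K M u y ↔ (K + 1) * u + y + (M + 1) * x < 1 := by
  unfold complementProb
  rw [lt_div_iff₀ (by positivity)]
  constructor <;> intro h <;> linarith

lemma complementProb_lt_one {K M : ℕ} {u y : ℝ} (hu : 0 < u) (hy : 0 ≤ y) :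
    complementProb K M u y < 1 := by
  unfold complementProb
  rw [div_lt_one (by positivity)]
  have : 0 < (K + 1) * u := by positivity
  have : (0 : ℝ) ≤ M := M.cast_nonneg
  linarith

/-- `rateSum` on the simplex, in the coordinates `(u, y)`. -/
noncomputable def simplexRate (K M : ℕ) (p : ℝ × ℝ) : ℝ :=
  rateSum K M p.1 p.2 (complementProb K M p.1 p.2)

/-- `halfSqRateSum` on the simplex, in the coordinates `(u, y)`. -/
noncomputable def simplexSqRate (K M : ℕ) (p : ℝ × ℝ) : ℝ :=
  halfSqRateSum K M p.1 p.2 (complementProb K M p.1 p.2)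

lemma contDiff_simplexRate (K M : ℕ) : ContDiff ℝ 1 (simplexRate K M) := by
  unfold simplexRate rateSum complementProb
  fun_prop

lemma contDiff_simplexSqRate (K M : ℕ) : ContDiff ℝ 1 (simplexSqRate K M) := by
  unfold simplexSqRate halfSqRateSum complementProb
  fun_prop

lemma fderiv_apply_eq_of_hasDerivAt_line {φ : ℝ × ℝ → ℝ} {x z d e c : ℝ}
    (hφ : DifferentiableAt ℝ φ (x, z))
    (h : HasDerivAt (fun t => φ (x + t * d, z + t * e)) c 0) : fderiv ℝ φ (x, z) (d, e) = c := by
  have hx : HasDerivAt (fun t : ℝ => x + t * d) d 0 := by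
    simpa using ((hasDerivAt_id (0 : ℝ)).mul_const d).const_add x
  have hz : HasDerivAt (fun t : ℝ => z + t * e) e 0 := by
    simpa using ((hasDerivAt_id (0 : ℝ)).mul_const e).const_add z
  have hφ' : HasFDerivAt φ (fderiv ℝ φ (x, z)) (x + 0 * d, z + 0 * e) := by
    simpa using hφ.hasFDerivAt
  exact (hφ'.comp_hasDerivAt (0 : ℝ) (hx.prodMk hz)).unique h

lemma hasDerivAt_complementProb {u y : ℝ → ℝ} {u' y' t : ℝ} (K M : ℕ) (hu : HasDerivAt u u' t)
    (hy : HasDerivAt y y' t) :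
    HasDerivAt (fun s => complementProb K M (u s) (y s)) (-((K + 1) * u' + y') / (M + 1)) t := by
  refine ((((hu.const_mul ((K : ℝ) + 1)).const_sub 1).fun_sub hy).div_const
    ((M : ℝ) + 1)).congr_deriv ?_
  ring

lemma fderiv_simplexRate_apply {K M : ℕ} {u y : ℝ} (d e : ℝ) (hu1 : u ≠ 1) (hy1 : y ≠ 1)
    (hv1 : complementProb K M u y ≠ 1) :
    fderiv ℝ (simplexRate K M) (u, y) (d, e)
      = idleProb K M u y (complementProb K M u y)
        * ((K + 1) * d * ((odds u - odds (complementProb K M u y))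
            * ((1 + odds u) + (1 + odds (complementProb K M u y))
              - oddsSum K M u y (complementProb K M u y)))
          + e * ((odds y - odds (complementProb K M u y))
            * ((1 + odds y) + (1 + odds (complementProb K M u y))
              - oddsSum K M u y (complementProb K M u y)))) := by
  refine fderiv_apply_eq_of_hasDerivAt_line
    ((contDiff_simplexRate K M).differentiable (by simp) _) ?_
  have hu : HasDerivAt (fun t : ℝ => u + t * d) d 0 := by
    simpa using ((hasDerivAt_id (0 : ℝ)).mul_const d).const_add u
  have hy : HasDerivAt (fun t : ℝ => y + t * e) e 0 := by
    simpa using ((hasDerivAt_id (0 : ℝ)).mul_const e).const_add y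
  refine (hasDerivAt_rateSum (K := K) (M := M) hu hy (hasDerivAt_complementProb K M hu hy)
    (by simpa using hu1) (by simpa using hy1) (by simpa using hv1)).congr_deriv ?_
  simp only [zero_mul, add_zero]
  rw [mul_div_cancel₀ _ (by positivity : (M : ℝ) + 1 ≠ 0)]
  ring

lemma fderiv_simplexSqRate_apply {K M : ℕ} {u y : ℝ} (d e : ℝ) (hu1 : u ≠ 1) (hy1 : y ≠ 1)
    (hv1 : complementProb K M u y ≠ 1) :
    fderiv ℝ (simplexSqRate K M) (u, y) (d, e)
      = idleProb K M u y (complementProb K M u y) ^ 2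
        * ((K + 1) * d * ((1 + odds u) ^ 3 - (1 + odds u) ^ 2
            - oddsSqSum K M u y (complementProb K M u y) * (1 + odds u))
          + e * ((1 + odds y) ^ 3 - (1 + odds y) ^ 2
            - oddsSqSum K M u y (complementProb K M u y) * (1 + odds y))
          - ((K + 1) * d + e) * ((1 + odds (complementProb K M u y)) ^ 3
            - (1 + odds (complementProb K M u y)) ^ 2
            - oddsSqSum K M u y (complementProb K M u y)
              * (1 + odds (complementProb K M u y)))) := by
  refine fderiv_apply_eq_of_hasDerivAt_line
    ((contDiff_simplexSqRate K M).differentiable (by simp) _) ?_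
  have hu : HasDerivAt (fun t : ℝ => u + t * d) d 0 := by
    simpa using ((hasDerivAt_id (0 : ℝ)).mul_const d).const_add u
  have hy : HasDerivAt (fun t : ℝ => y + t * e) e 0 := by
    simpa using ((hasDerivAt_id (0 : ℝ)).mul_const e).const_add y
  refine (hasDerivAt_halfSqRateSum (K := K) (M := M) hu hy (hasDerivAt_complementProb K M hu hy)
    (by simpa using hu1) (by simpa using hy1) (by simpa using hv1)).congr_deriv ?_
  simp only [zero_mul, add_zero]
  rw [mul_div_cancel₀ _ (by positivity : (M : ℝ) + 1 ≠ 0)]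
  ring

lemma idleProb_pos {K M : ℕ} {u y v : ℝ} (hu : u < 1) (hy : y < 1) (hv : v < 1) :
    0 < idleProb K M u y v := by
  have := sub_pos.2 hu
  have := sub_pos.2 hy
  have := sub_pos.2 hv
  unfold idleProb
  positivity

lemma fderiv_simplexRate_left_neg {K M : ℕ} {u y : ℝ} (hu : 0 < u) (hy : 0 ≤ y)
    (huv : u < complementProb K M u y) (hyv : y < complementProb K M u y) :
    fderiv ℝ (simplexRate K M) (u, y) (1, 0) < 0 := by
  have hv := complementProb_lt_one (K := K) (M := M) hu hy
  have hP := idleProb_pos (K := K) (M := M) (huv.trans hv) (hyv.trans hv) hv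
  have hw := vertex_slope_pos_left K M hu.le hy huv hyv hv (complementProb_sum K M u y)
  rw [fderiv_simplexRate_apply _ _ (huv.trans hv).ne (hyv.trans hv).ne hv.ne, zero_mul, add_zero,
    mul_one]
  exact mul_neg_of_pos_of_neg hP (mul_neg_of_pos_of_neg (by positivity)
    (mul_neg_of_neg_of_pos (sub_neg.2 (odds_lt_odds huv hv)) hw))

lemma fderiv_simplexRate_right_neg {K M : ℕ} {u y : ℝ} (hu : 0 < u) (hy : 0 ≤ y)
    (huv : u < complementProb K M u y) (hyv : y < complementProb K M u y) :
    fderiv ℝ (simplexRate K M) (u, y) (0, 1) < 0 := by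
  have hv := complementProb_lt_one (K := K) (M := M) hu hy
  have hP := idleProb_pos (K := K) (M := M) (huv.trans hv) (hyv.trans hv) hv
  have hw := vertex_slope_pos_right K M hu.le hy huv hyv hv (complementProb_sum K M u y)
  rw [fderiv_simplexRate_apply _ _ (huv.trans hv).ne (hyv.trans hv).ne hv.ne, mul_zero, zero_mul,
    zero_add, one_mul]
  exact mul_neg_of_pos_of_neg hP
    (mul_neg_of_neg_of_pos (sub_neg.2 (odds_lt_odds hyv hv)) hw)

lemma fderiv_simplexSqRate_pos_of_left {K M : ℕ} {u y e : ℝ} (hu : 0 < u) (huy : u < y)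
    (hyv : y < complementProb K M u y)
    (h : fderiv ℝ (simplexRate K M) (u, y) (1, e) = 0) :
    0 < fderiv ℝ (simplexSqRate K M) (u, y) (1, e) := by
  have hy := hu.trans huy
  have huv := huy.trans hyv
  have hv := complementProb_lt_one (K := K) (M := M) hu hy.le
  have hP := idleProb_pos (K := K) (M := M) (huv.trans hv) (hyv.trans hv) hv
  have hsum := complementProb_sum K M u y
  have hw := vertex_slope_pos_right K M hu.le hy.le huv hyv hv hsum
  have hE := tangent_factor_pos K M hu hy.le huv hyv hv hsum
  have h1 := sub_pos.2 (odds_lt_odds huy (hyv.trans hv))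
  have h2 := sub_pos.2 (odds_lt_odds huv hv)
  rw [fderiv_simplexRate_apply _ _ (huv.trans hv).ne (hyv.trans hv).ne hv.ne] at h
  have h := (mul_eq_zero.1 h).resolve_left hP.ne'
  rw [fderiv_simplexSqRate_apply _ _ (huv.trans hv).ne (hyv.trans hv).ne hv.ne]
  refine mul_pos (pow_pos hP 2) (pos_of_mul_pos_left ?_ hw.le)
  set R := oddsSum K M u y (complementProb K M u y)
  set S := oddsSqSum K M u y (complementProb K M u y)
  set a := odds (complementProb K M u y)
  set b := odds u
  set c := odds y
  have hK : (0 : ℝ) < K + 1 := by positivity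
  refine (mul_pos (mul_pos hK (mul_pos h1 h2)) hE).trans_eq ?_
  linear_combination (-((1 + c) ^ 2 + (1 + c) * (1 + a) + (1 + a) ^ 2 - (1 + c) - (1 + a) - S)) * h

lemma fderiv_simplexSqRate_pos_of_right {K M : ℕ} {u y d : ℝ} (hy : 0 ≤ y) (hyu : y < u)
    (huv : u < complementProb K M u y)
    (h : fderiv ℝ (simplexRate K M) (u, y) (d, 1) = 0) :
    0 < fderiv ℝ (simplexSqRate K M) (u, y) (d, 1) := by
  have hu := hy.trans_lt hyu
  have hyv := hyu.trans huv
  have hv := complementProb_lt_one (K := K) (M := M) hu hy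
  have hP := idleProb_pos (K := K) (M := M) (huv.trans hv) (hyv.trans hv) hv
  have hsum := complementProb_sum K M u y
  have hw := vertex_slope_pos_left K M hu.le hy huv hyv hv hsum
  have hE := tangent_factor_pos K M hu hy huv hyv hv hsum
  have h1 := sub_pos.2 (odds_lt_odds hyu (huv.trans hv))
  have h2 := sub_pos.2 (odds_lt_odds hyv hv)
  rw [fderiv_simplexRate_apply _ _ (huv.trans hv).ne (hyv.trans hv).ne hv.ne] at h
  have h := (mul_eq_zero.1 h).resolve_left hP.ne'
  rw [fderiv_simplexSqRate_apply _ _ (huv.trans hv).ne (hyv.trans hv).ne hv.ne]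
  refine mul_pos (pow_pos hP 2) (pos_of_mul_pos_left ?_ hw.le)
  set R := oddsSum K M u y (complementProb K M u y)
  set S := oddsSqSum K M u y (complementProb K M u y)
  set a := odds (complementProb K M u y)
  set b := odds u
  set c := odds y
  refine (mul_pos (mul_pos h1 h2) hE).trans_eq ?_
  linear_combination (-((1 + b) ^ 2 + (1 + b) * (1 + a) + (1 + a) ^ 2 - (1 + b) - (1 + a) - S)) * h

lemma strictAntiOn_simplexRate_zero (K M : ℕ) :
    StrictAntiOn (fun u => simplexRate K M (u, 0)) (Icc 0 (1 / (K + M + 2))) := by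
  refine strictAntiOn_of_deriv_neg (convex_Icc _ _)
    ((contDiff_simplexRate K M).continuous.comp (by fun_prop)).continuousOn fun u hu => ?_
  rw [interior_Icc] at hu
  have h := (lt_div_iff₀ (by positivity)).1 hu.2
  have huv : u < complementProb K M u 0 := lt_complementProb_iff.2 (by linarith)
  exact ((((contDiff_simplexRate K M).differentiable (by simp)) (u, 0)).hasFDerivAt.comp_hasDerivAt
    u ((hasDerivAt_id u).prodMk (hasDerivAt_const u 0))).deriv.trans_lt
    (fderiv_simplexRate_left_neg hu.1 le_rfl huv (hu.1.trans huv))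

lemma simplexRate_diag (K M : ℕ) (u : ℝ) :
    simplexRate K M (u, u) = simplexRate (K + 1) M (u, 0) := by
  simp only [simplexRate, rateSum, complementProb, pow_succ]
  push_cast
  ring_nf

lemma simplexSqRate_diag (K M : ℕ) (u : ℝ) :
    simplexSqRate K M (u, u) = simplexSqRate (K + 1) M (u, 0) := by
  simp only [simplexSqRate, halfSqRateSum, complementProb, pow_succ]
  push_cast
  ring_nf

lemma complementProb_self (K M : ℕ) (u : ℝ) :
    complementProb K M u (complementProb K (M + 1) u 0) = complementProb K (M + 1) u 0 := by
  have : (M : ℝ) + 1 + 1 ≠ 0 := by positivity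
  simp only [complementProb]
  push_cast
  field_simp
  ring

lemma simplexRate_complementProb (K M : ℕ) (u : ℝ) :
    simplexRate K M (u, complementProb K (M + 1) u 0) = simplexRate K (M + 1) (u, 0) := by
  simp only [simplexRate, complementProb_self]
  simp only [rateSum, pow_succ]
  push_cast
  ring

lemma simplexSqRate_complementProb (K M : ℕ) (u : ℝ) :
    simplexSqRate K M (u, complementProb K (M + 1) u 0) = simplexSqRate K (M + 1) (u, 0) := by
  simp only [simplexSqRate, complementProb_self]
  simp only [halfSqRateSum, pow_succ]
  push_cast
  ring

lemma simplexRate_complementProb_left (K M : ℕ) (y : ℝ) :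
    simplexRate K M (complementProb 0 (K + M + 1) y 0, y)
      = simplexRate 0 (K + M + 1) (y, 0) := by
  have h : complementProb K M (complementProb 0 (K + M + 1) y 0) y
      = complementProb 0 (K + M + 1) y 0 := by
    have : (K : ℝ) + M + 1 + 1 ≠ 0 := by positivity
    simp only [complementProb]
    push_cast
    field_simp
    ring
  simp only [simplexRate, h]
  simp only [rateSum, pow_succ, pow_add]
  push_cast
  ring

lemma plv_eq_complementProb (u : ℝ) (K M : ℕ) :
    plv u (K + 1) (K + M + 2) = complementProb K M u 0 := by
  simp only [plv, complementProb]
  push_cast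
  congr 1 <;> ring

lemma Tp_eq_simplexRate (u : ℝ) (K M : ℕ) :
    Tp u (K + 1) (K + M + 2) = simplexRate K M (u, 0) := by
  have h : K + M + 2 - (K + 1) = M + 1 := by omega
  simp only [Tp, xsv, xlv, plv_eq_complementProb, h, Nat.add_sub_cancel, simplexRate, rateSum,
    pow_succ]
  push_cast
  ring

lemma Fm1_eq_simplexSqRate (u : ℝ) (K M : ℕ) :
    Fm1 u (K + 1) (K + M + 2) = simplexSqRate K M (u, 0) := by
  have h : K + M + 2 - (K + 1) = M + 1 := by omega
  simp only [Fm1, xsv, xlv, plv_eq_complementProb, h, Nat.add_sub_cancel, simplexSqRate,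
    halfSqRateSum, pow_succ]
  push_cast
  ring

/-- Moving one component from the larger to the smaller value, at equal throughput. -/
lemma simplexSqRate_lt_of_split {K M : ℕ} {θ s t : ℝ} (hs : s ∈ Ioo 0 (1 / ((K : ℝ) + M + 3)))
    (ht : t ∈ Ioo 0 (1 / ((K : ℝ) + M + 3))) (hsθ : simplexRate K (M + 1) (s, 0) = θ)
    (htθ : simplexRate (K + 1) M (t, 0) = θ) :
    simplexSqRate K (M + 1) (s, 0) < simplexSqRate (K + 1) M (t, 0) := by
  have anti₁ := strictAntiOn_simplexRate_zero K (M + 1)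
  have anti₂ := strictAntiOn_simplexRate_zero (K + 1) M
  have e₁ : (K : ℝ) + (M + 1 : ℕ) + 2 = K + M + 3 := by push_cast; ring
  have e₂ : ((K + 1 : ℕ) : ℝ) + M + 2 = K + M + 3 := by push_cast; ring
  rw [e₁] at anti₁
  rw [e₂] at anti₂
  have hsmall : ∀ u ∈ Ioo 0 (1 / ((K : ℝ) + M + 3)), (K + M + 3) * u < 1 := by
    intro u hu
    have := (lt_div_iff₀ (by positivity)).1 hu.2
    linarith
  have hgap : ∀ u ∈ Ioo 0 (1 / ((K : ℝ) + M + 3)), u < complementProb K (M + 1) u 0 := by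
    intro u hu
    rw [lt_complementProb_iff]
    push_cast
    linarith [hsmall u hu]
  have hpart : ∀ u ∈ Ioo 0 (1 / ((K : ℝ) + M + 3)), ∀ z ∈ Ioo u (complementProb K (M + 1) u 0),
      z < complementProb K M u z := by
    intro u _ z hz
    have h := lt_complementProb_iff.1 hz.2
    push_cast at h
    exact lt_complementProb_iff.2 (by linarith)
  have hfz : ∀ u ∈ Ioo 0 (1 / ((K : ℝ) + M + 3)), ∀ z ∈ Ioo u (complementProb K (M + 1) u 0),
      fderiv ℝ (simplexRate K M) (u, z) (0, 1) < 0 := fun u hu z hz =>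
    fderiv_simplexRate_right_neg hu.1 (hu.1.trans hz.1).le (hz.1.trans (hpart u hu z hz))
      (hpart u hu z hz)
  have hst : s < t := by
    by_contra! hts
    have h1 : simplexRate (K + 1) M (s, 0) ≤ simplexRate (K + 1) M (t, 0) :=
      anti₂.antitoneOn (Ioo_subset_Icc_self ht) (Ioo_subset_Icc_self hs) hts
    have h2 : StrictAntiOn (fun z => simplexRate K M (s, z))
        (Icc s (complementProb K (M + 1) s 0)) := by
      refine strictAntiOn_of_deriv_neg (convex_Icc _ _)
        ((contDiff_simplexRate K M).continuous.comp (by fun_prop)).continuousOn fun z hz => ?_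
      rw [interior_Icc] at hz
      exact (((contDiff_simplexRate K M).differentiable
        (by simp) (s, z)).hasFDerivAt.comp_hasDerivAt z
        ((hasDerivAt_const z s).prodMk (hasDerivAt_id z))).deriv.trans_lt (hfz s hs z hz)
    have h3 : simplexRate K M (s, complementProb K (M + 1) s 0) < simplexRate K M (s, s) :=
      h2 (left_mem_Icc.2 (hgap s hs).le) (right_mem_Icc.2 (hgap s hs).le) (hgap s hs)
    rw [simplexRate_diag, simplexRate_complementProb] at h3
    linarith
  have hsub : Icc s t ⊆ Ioo 0 (1 / ((K : ℝ) + M + 3)) := fun u hu =>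
    ⟨hs.1.trans_le hu.1, hu.2.trans_lt ht.2⟩
  rw [← simplexSqRate_complementProb, ← simplexSqRate_diag]
  refine lt_of_level_curve (lo := fun u => u) (hi := fun u => complementProb K (M + 1) u 0)
    (θ := θ) hst (contDiff_simplexRate K M) (contDiff_simplexSqRate K M) continuous_id
    (by unfold complementProb; fun_prop)
    (fun u hu => (hgap u (hsub (Ioo_subset_Icc_self hu))).le) ?_ ?_
    (fun u hu => hfz u (hsub hu)) ?_ ⟨(hgap s hs).le, le_rfl⟩
    ((simplexRate_complementProb K M s).trans hsθ) ⟨le_rfl, (hgap t ht).le⟩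
    ((simplexRate_diag K M t).trans htθ)
  · intro u hu
    rw [simplexRate_diag, ← htθ]
    exact anti₂ (Ioo_subset_Icc_self (hsub (Ioo_subset_Icc_self hu))) (Ioo_subset_Icc_self ht) hu.2
  · intro u hu
    rw [simplexRate_complementProb, ← hsθ]
    exact anti₁ (Ioo_subset_Icc_self hs) (Ioo_subset_Icc_self (hsub (Ioo_subset_Icc_self hu))) hu.1
  · intro u hu z hz e he
    have hu' := hsub (Ioo_subset_Icc_self hu)
    exact fderiv_simplexSqRate_pos_of_left hu'.1 hz.1 (hpart u hu' z hz) he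

lemma fderiv_comp_swap {φ : ℝ × ℝ → ℝ} (hφ : ContDiff ℝ 1 φ) (x z d e : ℝ) :
    fderiv ℝ (fun p : ℝ × ℝ => φ p.swap) (x, z) (d, e) = fderiv ℝ φ (z, x) (e, d) := by
  have h : HasFDerivAt (fun p : ℝ × ℝ => p.swap)
      (ContinuousLinearEquiv.prodComm ℝ ℝ ℝ : ℝ × ℝ →L[ℝ] ℝ × ℝ) (x, z) :=
    (ContinuousLinearEquiv.prodComm ℝ ℝ ℝ).hasFDerivAt
  have h' := ((hφ.differentiable (by simp)) (z, x)).hasFDerivAt.comp (x, z) h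
  exact congrArg (fun L => L (d, e)) h'.fderiv

/-- Adding one component with the smaller value, at equal throughput. -/
lemma simplexSqRate_lt_of_add {K M : ℕ} {θ s t : ℝ} (hs : s ∈ Ioo 0 (1 / ((K : ℝ) + M + 2)))
    (ht : t ∈ Ioo 0 (1 / ((K : ℝ) + M + 3))) (hsθ : simplexRate K M (s, 0) = θ)
    (htθ : simplexRate (K + 1) M (t, 0) = θ) :
    simplexSqRate K M (s, 0) < simplexSqRate (K + 1) M (t, 0) := by
  have anti₁ := strictAntiOn_simplexRate_zero K M
  have anti₂ := strictAntiOn_simplexRate_zero (K + 1) M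
  have anti₃ := strictAntiOn_simplexRate_zero 0 (K + M + 1)
  have e₂ : ((K + 1 : ℕ) : ℝ) + M + 2 = K + M + 3 := by push_cast; ring
  have e₃ : ((0 : ℕ) : ℝ) + (K + M + 1 : ℕ) + 2 = K + M + 3 := by push_cast; ring
  rw [e₂] at anti₂
  rw [e₃] at anti₃
  have hsub : Icc 0 t ⊆ Icc 0 (1 / ((K : ℝ) + M + 3)) := Icc_subset_Icc_right ht.2.le
  have hgap : ∀ y ∈ Icc 0 t, y < complementProb 0 (K + M + 1) y 0 := by
    intro y hy
    have := (lt_div_iff₀ (by positivity)).1 (hy.2.trans_lt ht.2)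
    rw [lt_complementProb_iff]
    push_cast
    linarith
  have hpart : ∀ y ∈ Icc 0 t, ∀ z ∈ Ioo y (complementProb 0 (K + M + 1) y 0),
      z < complementProb K M z y := by
    intro y _ z hz
    have h := lt_complementProb_iff.1 hz.2
    push_cast at h
    exact lt_complementProb_iff.2 (by linarith)
  have htop : ∀ y ∈ Icc 0 t, simplexRate K M (complementProb 0 (K + M + 1) y 0, y) < θ := by
    intro y hy
    have h0 : complementProb 0 (K + M + 1) 0 0 = 1 / ((K : ℝ) + M + 2) := by
      simp only [complementProb]
      push_cast
      congr 1 <;> ring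
    calc simplexRate K M (complementProb 0 (K + M + 1) y 0, y)
        = simplexRate 0 (K + M + 1) (y, 0) := simplexRate_complementProb_left K M y
      _ ≤ simplexRate 0 (K + M + 1) (0, 0) :=
        anti₃.antitoneOn ⟨le_rfl, by positivity⟩ (hsub hy) hy.1
      _ = simplexRate K M (1 / ((K : ℝ) + M + 2), 0) := by
        rw [← simplexRate_complementProb_left, h0]
      _ < simplexRate K M (s, 0) :=
        anti₁ (Ioo_subset_Icc_self hs) ⟨by positivity, le_rfl⟩ hs.2
      _ = θ := hsθ
  have hs2 : s ≤ complementProb 0 (K + M + 1) 0 0 := by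
    have := (lt_div_iff₀ (by positivity)).1 hs.2
    refine (lt_complementProb_iff.2 ?_).le
    push_cast
    linarith
  rw [← simplexSqRate_diag]
  have hswap : ContDiff ℝ 1 (fun p : ℝ × ℝ => p.swap) := contDiff_snd.prodMk contDiff_fst
  refine lt_of_level_curve (f := fun p => simplexRate K M p.swap)
    (g := fun p => simplexSqRate K M p.swap) (lo := fun y => y)
    (hi := fun y => complementProb 0 (K + M + 1) y 0) (θ := θ) (a := 0) (b := t) (ya := s)
    (yb := t) ht.1
    ((contDiff_simplexRate K M).comp hswap) ((contDiff_simplexSqRate K M).comp hswap)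
    continuous_id (by unfold complementProb; fun_prop)
    (fun y hy => (hgap y (Ioo_subset_Icc_self hy)).le) ?_
    (fun y hy => htop y (Ioo_subset_Icc_self hy)) ?_ ?_ ⟨hs.1.le, hs2⟩ hsθ
    ⟨le_rfl, (hgap t (right_mem_Icc.2 ht.1.le)).le⟩ ((simplexRate_diag K M t).trans htθ)
  · intro y hy
    change θ < simplexRate K M (y, y)
    rw [simplexRate_diag, ← htθ]
    exact anti₂ (hsub (Ioo_subset_Icc_self hy)) (Ioo_subset_Icc_self ht) hy.2
  · intro y hy z hz
    rw [fderiv_comp_swap (contDiff_simplexRate K M)]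
    have hz' := hpart y hy z hz
    exact fderiv_simplexRate_left_neg (hy.1.trans_lt hz.1) hy.1 hz' (hz.1.trans hz')
  · intro y hy z hz d hd
    rw [fderiv_comp_swap (contDiff_simplexRate K M)] at hd
    rw [fderiv_comp_swap (contDiff_simplexSqRate K M)]
    exact fderiv_simplexSqRate_pos_of_right hy.1.le hz.1
      (hpart y (Ioo_subset_Icc_self hy) z hz) hd

theorem jain_objective_monotonicity (θ : ℝ) (hθ : θ ∈ Set.Ioo (0:ℝ) 1) :
    -- (1) fixed n', increasing k
    (∀ n' k : ℕ, 3 ≤ n' → 1 ≤ k → k ≤ n' - 2 →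
      ∀ ps ∈ Set.Ioo (0:ℝ) (1 / (n' : ℝ)), ∀ ps' ∈ Set.Ioo (0:ℝ) (1 / (n' : ℝ)),
        Tp ps k n' = θ → Tp ps' (k+1) n' = θ →
        Fm1 ps k n' < Fm1 ps' (k+1) n') ∧
    -- (2) both k and n' increased by one
    (∀ n' k : ℕ, 2 ≤ n' → 1 ≤ k → k ≤ n' - 1 →
      ∀ ps ∈ Set.Ioo (0:ℝ) (1 / (n' : ℝ)), ∀ ps'' ∈ Set.Ioo (0:ℝ) (1 / ((n' : ℝ) + 1)),
        Tp ps k n' = θ → Tp ps'' (k+1) (n'+1) = θ →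
        Fm1 ps k n' < Fm1 ps'' (k+1) (n'+1)) := by
  constructor
  · intro n' k hn hk hkn s hs t ht hsθ htθ
    obtain ⟨K, rfl⟩ : ∃ K, k = K + 1 := ⟨k - 1, by omega⟩
    obtain ⟨M, rfl⟩ : ∃ M, n' = K + (M + 1) + 2 := ⟨n' - K - 3, by omega⟩
    have e : K + (M + 1) + 2 = K + 1 + M + 2 := by omega
    have e' : ((K + (M + 1) + 2 : ℕ) : ℝ) = K + M + 3 := by push_cast; ring
    rw [e'] at hs ht
    rw [Tp_eq_simplexRate] at hsθ
    rw [e, Tp_eq_simplexRate] at htθ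
    rw [Fm1_eq_simplexSqRate, e, Fm1_eq_simplexSqRate]
    exact simplexSqRate_lt_of_split hs ht hsθ htθ
  · intro n' k hn hk hkn s hs t ht hsθ htθ
    obtain ⟨K, rfl⟩ : ∃ K, k = K + 1 := ⟨k - 1, by omega⟩
    obtain ⟨M, rfl⟩ : ∃ M, n' = K + M + 2 := ⟨n' - K - 2, by omega⟩
    have e : K + M + 2 + 1 = K + 1 + M + 2 := by omega
    have e' : ((K + M + 2 : ℕ) : ℝ) = K + M + 2 := by push_cast; ring
    have e'' : (K : ℝ) + M + 2 + 1 = K + M + 3 := by ring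
    rw [e'] at hs ht
    rw [e''] at ht
    rw [Tp_eq_simplexRate] at hsθ
    rw [e, Tp_eq_simplexRate] at htθ
    rw [Fm1_eq_simplexSqRate, e, Fm1_eq_simplexSqRate]
    exact simplexSqRate_lt_of_add hs ht hsθ htθ
end
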